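/- There exists a universal constant C > 0 such that the following holds. Let X be an isotropic log-concave random vector in ℝⁿ and let A = {X ∈ K}, where K is a convex set in ℝⁿ with 0 < P(A) ≤ 1/e. Then for every t > 0 and every u ≥ 1, ∑_{k=0}^∞ 4^k · |{i ≤ n : P(A ∩ {X_i ≥ 2^k t}) ≥ e^{−u} P(A)}| ≤ (C·u²/t²)·(σ_X²(−log P(A)) + n·𝟙{t ≤ u·C}). -/

import Mathlib

open MeasureTheory ProbabilityTheory Real
open scoped Pointwise ENNReal RealInnerProductSpace

noncomputable section

variable {Ω : Type*} [MeasurableSpace Ω]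

/-- A random vector `X` in `ℝⁿ` is log-concave: for all nonempty compact sets `K, L` and
`a ∈ [0,1]`, `P(X ∈ aK + (1-a)L) ≥ P(X ∈ K)^a * P(X ∈ L)^(1-a)`. -/
def IsLogConcave {n : ℕ} (μ : Measure Ω) (X : Ω → EuclideanSpace ℝ (Fin n)) : Prop :=
  ∀ K L : Set (EuclideanSpace ℝ (Fin n)), K.Nonempty → L.Nonempty →
    IsCompact K → IsCompact L → ∀ a : ℝ, 0 ≤ a → a ≤ 1 →
      (μ (X ⁻¹' K)).toReal ^ a * (μ (X ⁻¹' L)).toReal ^ (1 - a) ≤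
        (μ (X ⁻¹' (a • K + (1 - a) • L))).toReal

/-- `X` is isotropic: centered with identity covariance matrix. -/
def IsIsotropic {n : ℕ} (μ : Measure Ω) (X : Ω → EuclideanSpace ℝ (Fin n)) : Prop :=
  (∀ i, ∫ ω, X ω i ∂μ = 0) ∧
  ∀ i j, ∫ ω, X ω i * X ω j ∂μ = if i = j then (1 : ℝ) else 0

/-- `σ_X(p) = sup_{|t| = 1} (E|⟨t,X⟩|^p)^(1/p)`. -/
def sigmaX {n : ℕ} (μ : Measure Ω) (X : Ω → EuclideanSpace ℝ (Fin n)) (p : ℝ) : ℝ :=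
  ⨆ t : {t : EuclideanSpace ℝ (Fin n) // ‖t‖ = 1},
    (∫ ω, |⟪t.1, X ω⟫| ^ p ∂μ) ^ (1 / p)

/-- Generalized inverse of `σ_X`. -/
def sigmaXInv {n : ℕ} (μ : Measure Ω) (X : Ω → EuclideanSpace ℝ (Fin n)) (s : ℝ) : ℝ :=
  sSup {p : ℝ | 1 ≤ p ∧ sigmaX μ X p ≤ s}

/-- The Brunn–Minkowski form of log-concavity of a measure, for measurable sets. -/
def LogConcaveMeasure {F : Type*} [AddCommGroup F] [Module ℝ F] [MeasurableSpace F]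
    (ν : Measure F) : Prop :=
  ∀ S T D : Set F, MeasurableSet S → MeasurableSet T → MeasurableSet D →
    ∀ a : ℝ, 0 < a → a < 1 → (∀ x ∈ S, ∀ y ∈ T, a • x + (1 - a) • y ∈ D) →
      ν.real S ^ a * ν.real T ^ (1 - a) ≤ ν.real D

lemma exists_isCompact_mul_lt_measureReal {F : Type*} [TopologicalSpace F] [MeasurableSpace F]
    (ν : Measure F) [IsFiniteMeasure ν] [ν.InnerRegular] {S : Set F} (hS : MeasurableSet S)
    (h0 : 0 < ν.real S) {c : ℝ} (hc0 : 0 ≤ c) (hc : c < 1) :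
    ∃ K ⊆ S, IsCompact K ∧ c * ν.real S < ν.real K := by
  have h1 : ENNReal.ofReal (c * ν.real S) < ν S := by
    rw [ENNReal.ofReal_lt_iff_lt_toReal (by positivity) (measure_ne_top _ _)]
    change c * ν.real S < ν.real S
    nlinarith
  obtain ⟨K, hK, hKc, hlt⟩ := hS.exists_lt_isCompact h1
  refine ⟨K, hK, hKc, ?_⟩
  rwa [ENNReal.ofReal_lt_iff_lt_toReal (by positivity) (measure_ne_top _ _)] at hlt

lemma IsLogConcave.logConcaveMeasure_map {n : ℕ} {μ : Measure Ω} [IsProbabilityMeasure μ]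
    {X : Ω → EuclideanSpace ℝ (Fin n)} (hX : Measurable X) (h : IsLogConcave μ X) :
    LogConcaveMeasure (μ.map X) := by
  intro S T D hS hT hD a ha0 ha1 hsub
  have : IsProbabilityMeasure (μ.map X) := Measure.isProbabilityMeasure_map hX.aemeasurable
  set ν := μ.map X
  rcases (measureReal_nonneg (μ := ν) (s := S)).eq_or_lt with hS0 | hS0
  · rw [← hS0, Real.zero_rpow ha0.ne', zero_mul]; exact measureReal_nonneg
  rcases (measureReal_nonneg (μ := ν) (s := T)).eq_or_lt with hT0 | hT0
  · rw [← hT0, Real.zero_rpow (by linarith), mul_zero]; exact measureReal_nonneg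
  have key : ∀ c ∈ Set.Ioo (0 : ℝ) 1, c * (ν.real S ^ a * ν.real T ^ (1 - a)) ≤ ν.real D := by
    intro c hc
    obtain ⟨K, hK, hKc, hKlt⟩ :=
      exists_isCompact_mul_lt_measureReal ν hS hS0 hc.1.le hc.2
    obtain ⟨L, hL, hLc, hLlt⟩ :=
      exists_isCompact_mul_lt_measureReal ν hT hT0 hc.1.le hc.2
    have hne : ∀ {U V : Set (EuclideanSpace ℝ (Fin n))}, 0 < ν.real V →
        c * ν.real V < ν.real U → U.Nonempty := by
      intro U V hV hU
      rw [Set.nonempty_iff_ne_empty]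
      rintro rfl
      have := mul_pos hc.1 hV
      simp at hU
      linarith
    have hmap : ∀ {U : Set (EuclideanSpace ℝ (Fin n))}, MeasurableSet U →
        (μ (X ⁻¹' U)).toReal = ν.real U := by
      intro U hU
      rw [measureReal_def, Measure.map_apply hX hU]
    have h1 := h K L (hne hS0 hKlt) (hne hT0 hLlt) hKc hLc a ha0.le ha1.le
    rw [hmap hKc.measurableSet, hmap hLc.measurableSet,
      hmap ((hKc.smul a).add (hLc.smul (1 - a))).measurableSet] at h1
    have h2 : ν.real (a • K + (1 - a) • L) ≤ ν.real D := by
      refine measureReal_mono ?_ (measure_ne_top _ _)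
      rintro _ ⟨_, ⟨x, hx, rfl⟩, _, ⟨y, hy, rfl⟩, rfl⟩
      exact hsub x (hK hx) y (hL hy)
    calc c * (ν.real S ^ a * ν.real T ^ (1 - a))
        = (c * ν.real S) ^ a * (c * ν.real T) ^ (1 - a) := by
          rw [Real.mul_rpow hc.1.le hS0.le, Real.mul_rpow hc.1.le hT0.le]
          have : c ^ a * c ^ (1 - a) = c := by
            rw [← Real.rpow_add hc.1]; simp
          linear_combination (-(ν.real S ^ a * ν.real T ^ (1 - a))) * this
      _ ≤ ν.real K ^ a * ν.real L ^ (1 - a) := by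
          have := hc.1
          gcongr
      _ ≤ ν.real D := h1.trans h2
  have hlim : Filter.Tendsto (fun c : ℝ => c * (ν.real S ^ a * ν.real T ^ (1 - a)))
      (nhdsWithin 1 (Set.Iio 1)) (nhds (1 * (ν.real S ^ a * ν.real T ^ (1 - a)))) :=
    ((continuous_id.mul continuous_const).tendsto (1 : ℝ)).mono_left nhdsWithin_le_nhds
  rw [one_mul] at hlim
  refine le_of_tendsto hlim ?_
  filter_upwards [Ioo_mem_nhdsLT (show (0 : ℝ) < 1 by norm_num)] with c hc using key c hc

lemma LogConcaveMeasure.map {F G : Type*} [AddCommGroup F] [Module ℝ F] [MeasurableSpace F]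
    [AddCommGroup G] [Module ℝ G] [MeasurableSpace G] {ν : Measure F}
    (h : LogConcaveMeasure ν) (f : F →ₗ[ℝ] G) (hf : Measurable f) :
    LogConcaveMeasure (ν.map f) := by
  intro S T D hS hT hD a ha0 ha1 hsub
  simp only [measureReal_def, Measure.map_apply hf hS, Measure.map_apply hf hT,
    Measure.map_apply hf hD]
  refine h _ _ _ (hf hS) (hf hT) (hf hD) a ha0 ha1 fun x hx y hy => ?_
  simpa using hsub (f x) hx (f y) hy

section GaussianTails

lemma gaussianReal_real_Ici_le {a : ℝ} (ha : 0 ≤ a) :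
    (gaussianReal 0 1).real (Set.Ici a) ≤ Real.exp (-(a ^ 2 / 2)) := by
  have h := measure_ge_le_exp_mul_mgf (μ := gaussianReal 0 1) (X := id) a ha
    (by simpa using integrable_exp_mul_gaussianReal a)
  rw [mgf_gaussianReal Measure.map_id a, ← Real.exp_add] at h
  refine h.trans (Real.exp_le_exp.2 ?_)
  simp only [NNReal.coe_one]
  nlinarith

lemma exp_le_gaussianReal_real_Ici {a : ℝ} (ha : 0 ≤ a) :
    Real.exp (-((a + 1) ^ 2 / 2) - 1) ≤ (gaussianReal 0 1).real (Set.Ici a) := by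
  have hsub : (gaussianReal 0 1).real (Set.Icc a (a + 1)) ≤ (gaussianReal 0 1).real (Set.Ici a) :=
    measureReal_mono Set.Icc_subset_Ici_self
  refine le_trans ?_ hsub
  have hint : ∀ s, IntegrableOn (gaussianPDFReal 0 1) s :=
    fun s => (integrable_gaussianPDFReal 0 1).integrableOn
  rw [measureReal_def, gaussianReal_apply_eq_integral 0 one_ne_zero,
    ENNReal.toReal_ofReal (integral_nonneg fun x => gaussianPDFReal_nonneg 0 1 x)]
  have hpi : Real.exp (-1) ≤ (√(2 * π))⁻¹ := by
    rw [Real.exp_neg]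
    apply inv_anti₀ (by positivity)
    rw [Real.sqrt_le_left (by positivity)]
    have h1 := Real.exp_one_gt_d9
    have h2 := Real.pi_lt_d2
    nlinarith
  calc Real.exp (-((a + 1) ^ 2 / 2) - 1)
      = ∫ _ in Set.Icc a (a + 1), Real.exp (-((a + 1) ^ 2 / 2) - 1) := by simp
    _ ≤ ∫ x in Set.Icc a (a + 1), gaussianPDFReal 0 1 x := by
      refine setIntegral_mono_on (by simp) (hint _) measurableSet_Icc fun x hx => ?_
      simp only [gaussianPDFReal, NNReal.coe_one, mul_one, sub_zero]
      rw [sub_eq_add_neg, Real.exp_add, mul_comm]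
      gcongr
      rw [neg_div, neg_le_neg_iff]
      have := hx.1
      have := hx.2
      have : 0 ≤ x := by linarith
      gcongr

variable {F : Type*} [NormedAddCommGroup F] [InnerProductSpace ℝ F] [FiniteDimensional ℝ F]
  [MeasurableSpace F] [BorelSpace F]

lemma stdGaussian_map_inner {v : F} (hv : ‖v‖ = 1) :
    (stdGaussian F).map (fun θ => ⟪v, θ⟫) = gaussianReal 0 1 := by
  have h := IsGaussian.map_eq_gaussianReal (μ := stdGaussian F) (innerSL ℝ v)
  rw [variance_dual_stdGaussian, integral_strongDual_stdGaussian, innerSL_apply_norm, hv] at h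
  simpa using h

lemma stdGaussian_real_halfspace {x : F} (hx : x ≠ 0) (a : ℝ) :
    (stdGaussian F).real {θ | a * ‖x‖ ≤ ⟪x, θ⟫} = (gaussianReal 0 1).real (Set.Ici a) := by
  have hn : 0 < ‖x‖ := norm_pos_iff.2 hx
  rw [← stdGaussian_map_inner (v := ‖x‖⁻¹ • x) (by rw [norm_smul]; simp [hn.ne']),
    measureReal_def, measureReal_def, Measure.map_apply (by fun_prop) measurableSet_Ici]
  congr 2
  ext θ
  simp [inner_smul_left, le_inv_mul_iff₀ hn, mul_comm a]

lemma stdGaussian_real_inter_halfspace_le {x y : F} (hx : x ≠ 0) (hy : y ≠ 0) {a ε : ℝ}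
    (ha : 0 < a) (hxy : ⟪x, y⟫ ≤ ε * ‖x‖ * ‖y‖) :
    (stdGaussian F).real {θ | a * ‖x‖ ≤ ⟪x, θ⟫ ∧ a * ‖y‖ ≤ ⟪y, θ⟫} ≤
      Real.exp (-(a ^ 2 * (1 - ε))) := by
  have hnx : 0 < ‖x‖ := norm_pos_iff.2 hx
  have hny : 0 < ‖y‖ := norm_pos_iff.2 hy
  set v : F := ‖x‖⁻¹ • x + ‖y‖⁻¹ • y with hv
  have hv2 : ‖v‖ ^ 2 ≤ 2 + 2 * ε := by
    rw [hv, norm_add_sq_real, norm_smul, norm_smul, inner_smul_left, inner_smul_right]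
    have : ‖x‖⁻¹ * (‖y‖⁻¹ * ⟪x, y⟫) ≤ ε := by
      rw [inv_mul_le_iff₀ hnx, inv_mul_le_iff₀ hny]; linarith
    simp only [norm_inv, norm_norm, inv_mul_cancel₀ hnx.ne', inv_mul_cancel₀ hny.ne',
      conj_trivial]
    linarith
  have hsub : {θ : F | a * ‖x‖ ≤ ⟪x, θ⟫ ∧ a * ‖y‖ ≤ ⟪y, θ⟫} ⊆ {θ | 2 * a ≤ ⟪v, θ⟫} := by
    rintro θ ⟨h1, h2⟩
    simp only [Set.mem_ofPred_eq, hv, inner_add_left, inner_smul_left, conj_trivial]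
    have h1 : a ≤ ‖x‖⁻¹ * ⟪x, θ⟫ := by rw [le_inv_mul_iff₀ hnx]; linarith
    have h2 : a ≤ ‖y‖⁻¹ * ⟪y, θ⟫ := by rw [le_inv_mul_iff₀ hny]; linarith
    linarith
  refine (measureReal_mono hsub).trans ?_
  by_cases hv0 : v = 0
  · have : {θ : F | 2 * a ≤ ⟪v, θ⟫} = ∅ := by
      ext θ; simp [hv0, ha]
    rw [this]; simp; positivity
  have hnv : 0 < ‖v‖ := norm_pos_iff.2 hv0
  have := stdGaussian_real_halfspace hv0 (2 * a / ‖v‖)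
  rw [div_mul_cancel₀ _ hnv.ne'] at this
  rw [this]
  refine (gaussianReal_real_Ici_le (by positivity)).trans (Real.exp_le_exp.2 ?_)
  rw [neg_le_neg_iff, div_pow, le_div_iff₀ (by norm_num), le_div_iff₀ (by positivity)]
  rcases le_total ε 1 with h | h
  · have : a ^ 2 * (1 - ε) * 2 * ‖v‖ ^ 2 ≤ a ^ 2 * (1 - ε) * 2 * (2 + 2 * ε) :=
      mul_le_mul_of_nonneg_left hv2 (by have := sub_nonneg.2 h; positivity)
    nlinarith [mul_nonneg (sq_nonneg a) (sq_nonneg ε)]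
  · have : a ^ 2 * (1 - ε) * 2 * ‖v‖ ^ 2 ≤ 0 := by
      have : 0 ≤ a ^ 2 * (ε - 1) * 2 * ‖v‖ ^ 2 := by
        have := sub_nonneg.2 h; positivity
      linarith
    nlinarith

end GaussianTails

section SectionMeasures

lemma measurableSet_setOf_and {α : Type*} [MeasurableSpace α] {p q : α → Prop}
    (hp : MeasurableSet {x | p x}) (hq : MeasurableSet {x | q x}) :
    MeasurableSet {x | p x ∧ q x} := hp.inter hq

variable {α β : Type*} [MeasurableSpace α] [MeasurableSpace β]

lemma integral_measureReal_section (γ : Measure α) (ν : Measure β) [IsProbabilityMeasure γ]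
    [IsProbabilityMeasure ν] {R : Set (α × β)} (hR : MeasurableSet R) :
    ∫ x, ν.real {y | (x, y) ∈ R} ∂γ = ∫ y, γ.real {x | (x, y) ∈ R} ∂ν := by
  have h1 : ∫ x, ν.real {y | (x, y) ∈ R} ∂γ = ((γ.prod ν) R).toReal := by
    rw [Measure.prod_apply hR]
    exact integral_toReal (measurable_measure_prodMk_left hR).aemeasurable
      (Filter.Eventually.of_forall fun _ => measure_lt_top _ _)
  have h2 : ∫ y, γ.real {x | (x, y) ∈ R} ∂ν = ((γ.prod ν) R).toReal := by
    rw [Measure.prod_apply_symm hR]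
    exact integral_toReal (measurable_measure_prodMk_right hR).aemeasurable
      (Filter.Eventually.of_forall fun _ => measure_lt_top _ _)
  rw [h1, h2]

lemma measurable_measureReal_section (ν : Measure β) [IsProbabilityMeasure ν]
    {R : Set (α × β)} (hR : MeasurableSet R) :
    Measurable fun x => ν.real {y | (x, y) ∈ R} :=
  (measurable_measure_prodMk_left hR).ennreal_toReal

lemma integrable_measureReal_section (γ : Measure α) (ν : Measure β) [IsProbabilityMeasure γ]
    [IsProbabilityMeasure ν] {R : Set (α × β)} (hR : MeasurableSet R) :
    Integrable (fun x => ν.real {y | (x, y) ∈ R}) γ :=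
  Integrable.of_bound (measurable_measureReal_section ν hR).aestronglyMeasurable 1
    (Filter.Eventually.of_forall fun x => by
      rw [Real.norm_of_nonneg measureReal_nonneg]; exact measureReal_le_one)

/-- The Paley–Zygmund inequality at half of the mean. -/
lemma sq_integral_div_le_measureReal (γ : Measure α) [IsProbabilityMeasure γ] {f : α → ℝ}
    (hf : Measurable f) (hfi : Integrable f γ) (hfi2 : Integrable (fun x => f x ^ 2) γ)
    (hm : 0 < ∫ x, f x ∂γ) {q : ℝ} (hq : 0 < q)
    (hfq : ∫ x, f x ^ 2 ∂γ ≤ q) :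
    (∫ x, f x ∂γ) ^ 2 / (4 * q) ≤ γ.real {x | (∫ x, f x ∂γ) / 2 ≤ f x} := by
  set m := ∫ x, f x ∂γ with hm_def
  set G := {x | m / 2 ≤ f x} with hG
  have hGm : MeasurableSet G := measurableSet_le measurable_const hf
  set t := m / (2 * q) with ht
  have ht0 : 0 < t := by positivity
  have hind : Integrable (G.indicator (fun _ => (1 : ℝ))) γ :=
    (integrable_const 1).indicator hGm
  have hi1 : Integrable (fun x => t / 2 * f x ^ 2) γ := hfi2.const_mul _
  have hi2 : Integrable (fun x => 1 / (2 * t) * G.indicator (fun _ => (1 : ℝ)) x) γ :=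
    hind.const_mul _
  have hi3 : Integrable
      (fun x => t / 2 * f x ^ 2 + 1 / (2 * t) * G.indicator (fun _ => (1 : ℝ)) x) γ := hi1.add hi2
  have hle : m ≤ ∫ x, (m / 2 + (t / 2 * f x ^ 2 + 1 / (2 * t) * G.indicator (fun _ => (1 : ℝ)) x)) ∂γ := by
    refine integral_mono hfi ((integrable_const _).add hi3) fun x => ?_
    by_cases hx : x ∈ G
    · simp only [Set.indicator_of_mem hx]
      have : 0 ≤ (t * f x - 1) ^ 2 / (2 * t) := by positivity
      have h2 : (t * f x - 1) ^ 2 / (2 * t) = t / 2 * f x ^ 2 + 1 / (2 * t) - f x := by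
        field_simp; ring
      linarith
    · simp only [Set.indicator_of_notMem hx]
      have h1 : f x < m / 2 := by simpa [hG] using hx
      have : 0 ≤ t / 2 * f x ^ 2 := by positivity
      linarith
  rw [integral_add (integrable_const _) hi3, integral_add hi1 hi2, integral_const_mul, integral_const_mul,
    integral_indicator_const _ hGm] at hle
  simp only [integral_const, probReal_univ, smul_eq_mul, one_mul, mul_one] at hle
  have h3 : t / 2 * ∫ x, f x ^ 2 ∂γ ≤ m / 4 := by
    calc t / 2 * ∫ x, f x ^ 2 ∂γ ≤ t / 2 * q := by gcongr
      _ = m / 4 := by rw [ht]; field_simp; ring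
  have h4 : 1 / (2 * t) * γ.real G = q / m * γ.real G := by rw [ht]; field_simp
  rw [h4] at hle
  have h5 : m / 4 ≤ q / m * γ.real G := by linarith
  rw [div_mul_eq_mul_div, le_div_iff₀ hm] at h5
  rw [div_le_iff₀ (by positivity)]
  nlinarith

end SectionMeasures

section RandomFunctional

variable {F : Type*} [NormedAddCommGroup F] [InnerProductSpace ℝ F] [FiniteDimensional ℝ F]
  [MeasurableSpace F] [BorelSpace F] {ν : Measure F} [IsProbabilityMeasure ν]

lemma integral_measureReal_cone {b a : ℝ} (hb : 0 < b) :
    ∫ θ, ν.real {x | b ≤ ‖x‖ ∧ a * ‖x‖ ≤ ⟪x, θ⟫} ∂(stdGaussian F) =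
      ν.real {x | b ≤ ‖x‖} * (gaussianReal 0 1).real (Set.Ici a) := by
  have hR : MeasurableSet {z : F × F | b ≤ ‖z.2‖ ∧ a * ‖z.2‖ ≤ ⟪z.2, z.1⟫} :=
    measurableSet_setOf_and (measurableSet_le (by fun_prop) (by fun_prop))
      (measurableSet_le (by fun_prop) (by fun_prop))
  refine (integral_measureReal_section (stdGaussian F) ν hR).trans ?_
  have hS : MeasurableSet {x : F | b ≤ ‖x‖} := measurableSet_le (by fun_prop) (by fun_prop)
  have : (fun y : F => (stdGaussian F).real
        {x | (x, y) ∈ {z : F × F | b ≤ ‖z.2‖ ∧ a * ‖z.2‖ ≤ ⟪z.2, z.1⟫}}) =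
      {x : F | b ≤ ‖x‖}.indicator (fun _ => (gaussianReal 0 1).real (Set.Ici a)) := by
    ext y
    by_cases hy : b ≤ ‖y‖
    · rw [Set.indicator_of_mem (by exact hy),
        ← stdGaussian_real_halfspace (norm_pos_iff.1 (hb.trans_le hy)) a]
      congr 1
      ext θ
      simp [hy]
    · rw [Set.indicator_of_notMem (by exact hy)]
      simp [hy]
  rw [this, integral_indicator_const _ hS, smul_eq_mul]

lemma integral_measureReal_halfspace_le {a : ℝ} (ha : 0 ≤ a) :
    ∫ θ, ν.real {x | x ≠ 0 ∧ a * ‖x‖ ≤ ⟪x, θ⟫} ∂(stdGaussian F) ≤ Real.exp (-(a ^ 2 / 2)) := by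
  have hR : MeasurableSet {z : F × F | z.2 ≠ 0 ∧ a * ‖z.2‖ ≤ ⟪z.2, z.1⟫} :=
    measurableSet_setOf_and (measurable_snd (measurableSet_singleton (0 : F)).compl)
      (measurableSet_le (by fun_prop) (by fun_prop))
  refine (integral_measureReal_section (stdGaussian F) ν hR).trans_le ?_
  have hle : ∀ y : F, (stdGaussian F).real
      {x | (x, y) ∈ {z : F × F | z.2 ≠ 0 ∧ a * ‖z.2‖ ≤ ⟪z.2, z.1⟫}} ≤
        Real.exp (-(a ^ 2 / 2)) := by
    intro y
    by_cases hy : y = 0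
    · simp [hy, Real.exp_nonneg]
    · refine le_trans (le_of_eq ?_) (gaussianReal_real_Ici_le ha)
      rw [← stdGaussian_real_halfspace hy a]
      congr 1
      ext θ
      simp [hy]
  calc _ ≤ ∫ _ : F, Real.exp (-(a ^ 2 / 2)) ∂ν :=
        integral_mono_of_nonneg (Filter.Eventually.of_forall fun _ => measureReal_nonneg)
          (integrable_const _) (Filter.Eventually.of_forall hle)
    _ = _ := by simp

lemma integral_sq_measureReal_cone_le {b a ε δ : ℝ} (hb : 0 < b) (ha : 0 < a) (hε : 0 ≤ ε)
    (hdir : ∀ v : F, ‖v‖ = 1 → ν.real {x | ε * b ≤ ⟪v, x⟫} ≤ δ * ν.real {x | b ≤ ‖x‖})  :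
    ∫ θ, ν.real {x | b ≤ ‖x‖ ∧ a * ‖x‖ ≤ ⟪x, θ⟫} ^ 2 ∂(stdGaussian F) ≤
      ν.real {x | b ≤ ‖x‖} ^ 2 * (Real.exp (-(a ^ 2 * (1 - ε))) + δ) := by
  set S := {x : F | b ≤ ‖x‖} with hS_def
  have hS : MeasurableSet S := measurableSet_le (by fun_prop) (by fun_prop)
  set R := {z : F × (F × F) | (b ≤ ‖z.2.1‖ ∧ a * ‖z.2.1‖ ≤ ⟪z.2.1, z.1⟫) ∧
    (b ≤ ‖z.2.2‖ ∧ a * ‖z.2.2‖ ≤ ⟪z.2.2, z.1⟫)} with hR_def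
  have hR : MeasurableSet R :=
    measurableSet_setOf_and
      (measurableSet_setOf_and (measurableSet_le (by fun_prop) (by fun_prop))
        (measurableSet_le (by fun_prop) (by fun_prop)))
      (measurableSet_setOf_and (measurableSet_le (by fun_prop) (by fun_prop))
        (measurableSet_le (by fun_prop) (by fun_prop)))
  set W := {z : F × F | (b ≤ ‖z.1‖ ∧ b ≤ ‖z.2‖) ∧ ε * ‖z.1‖ * ‖z.2‖ ≤ ⟪z.1, z.2⟫} with hW_def
  have hW : MeasurableSet W :=
    measurableSet_setOf_and
      (measurableSet_setOf_and (measurableSet_le (by fun_prop) (by fun_prop))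
        (measurableSet_le (by fun_prop) (by fun_prop)))
      (measurableSet_le (by fun_prop) (by fun_prop))
  have hsq : ∀ θ : F, ν.real {x | b ≤ ‖x‖ ∧ a * ‖x‖ ≤ ⟪x, θ⟫} ^ 2 =
      (ν.prod ν).real {y | (θ, y) ∈ R} := by
    intro θ
    rw [sq, ← measureReal_prod_prod]
    rfl
  simp_rw [hsq]
  rw [integral_measureReal_section (stdGaussian F) (ν.prod ν) hR]
  have hWint : (ν.prod ν).real W ≤ ν.real S ^ 2 * δ := by
    have h1 : ∫ x, ν.real {y | (x, y) ∈ W} ∂ν = (ν.prod ν).real W := by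
      rw [measureReal_def, Measure.prod_apply hW]
      exact integral_toReal (measurable_measure_prodMk_left hW).aemeasurable
        (Filter.Eventually.of_forall fun _ => measure_lt_top _ _)
    rw [← h1]
    calc ∫ x, ν.real {y | (x, y) ∈ W} ∂ν
        ≤ ∫ x, S.indicator (fun _ => δ * ν.real S) x ∂ν := by
          refine integral_mono (integrable_measureReal_section ν ν hW)
            ((integrable_const _).indicator hS) fun x => ?_
          by_cases hx : b ≤ ‖x‖
          · rw [Set.indicator_of_mem (by exact hx)]
            have hx0 : 0 < ‖x‖ := hb.trans_le hx
            refine le_trans (measureReal_mono ?_) (hdir (‖x‖⁻¹ • x) ?_)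
            · rintro y ⟨⟨-, hy⟩, h⟩
              simp only [Set.mem_ofPred_eq, inner_smul_left, conj_trivial]
              rw [le_inv_mul_iff₀ hx0]
              have : ε * ‖x‖ * b ≤ ε * ‖x‖ * ‖y‖ := by gcongr
              simp only at h
              linarith
            · rw [norm_smul]; simp [hx0.ne']
          · rw [Set.indicator_of_notMem (by exact hx)]
            simp [hW_def, hx]
      _ = ν.real S ^ 2 * δ := by
          rw [integral_indicator_const _ hS, smul_eq_mul]; ring
  have hpt : ∀ z : F × F, (stdGaussian F).real {θ | (θ, z) ∈ R} ≤
      (S ×ˢ S).indicator (fun _ => Real.exp (-(a ^ 2 * (1 - ε)))) z +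
        W.indicator (fun _ => (1 : ℝ)) z := by
    rintro ⟨x, y⟩
    by_cases hxy : b ≤ ‖x‖ ∧ b ≤ ‖y‖
    · rw [Set.indicator_of_mem (show (x, y) ∈ S ×ˢ S from hxy)]
      by_cases hw : (x, y) ∈ W
      · rw [Set.indicator_of_mem hw]
        have : (stdGaussian F).real {θ | (θ, (x, y)) ∈ R} ≤ 1 := measureReal_le_one
        have := Real.exp_nonneg (-(a ^ 2 * (1 - ε)))
        linarith
      · rw [Set.indicator_of_notMem hw, add_zero]
        have h2 : ⟪x, y⟫ ≤ ε * ‖x‖ * ‖y‖ := by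
          by_contra! h
          exact hw ⟨hxy, h.le⟩
        refine le_trans (measureReal_mono ?_) (stdGaussian_real_inter_halfspace_le
          (norm_pos_iff.1 (hb.trans_le hxy.1)) (norm_pos_iff.1 (hb.trans_le hxy.2)) ha h2)
        rintro θ ⟨⟨-, h1⟩, ⟨-, h2⟩⟩
        exact ⟨h1, h2⟩
    · have : {θ : F | (θ, (x, y)) ∈ R} = ∅ := by
        ext θ
        simp only [hR_def, Set.mem_ofPred_eq, Set.mem_empty_iff_false, iff_false]
        rintro ⟨⟨h1, -⟩, ⟨h2, -⟩⟩
        exact hxy ⟨h1, h2⟩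
      rw [this, measureReal_empty]
      exact add_nonneg (Set.indicator_nonneg (fun _ _ => Real.exp_nonneg _) _)
        (Set.indicator_nonneg (fun _ _ => zero_le_one) _)
  have hi1 : Integrable ((S ×ˢ S).indicator (fun _ : F × F => Real.exp (-(a ^ 2 * (1 - ε)))))
      (ν.prod ν) := (integrable_const _).indicator (hS.prod hS)
  have hi2 : Integrable (W.indicator (fun _ : F × F => (1 : ℝ))) (ν.prod ν) :=
    (integrable_const _).indicator hW
  calc _ ≤ ∫ z, ((S ×ˢ S).indicator (fun _ => Real.exp (-(a ^ 2 * (1 - ε)))) z +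
        W.indicator (fun _ => (1 : ℝ)) z) ∂(ν.prod ν) :=
        integral_mono_of_nonneg (Filter.Eventually.of_forall fun _ => measureReal_nonneg)
          (hi1.add hi2) (Filter.Eventually.of_forall hpt)
    _ = ν.real S ^ 2 * Real.exp (-(a ^ 2 * (1 - ε))) + (ν.prod ν).real W := by
        rw [integral_add hi1 hi2, integral_indicator_const _ (hS.prod hS),
          integral_indicator_const _ hW, measureReal_prod_prod]
        simp [sq]
    _ ≤ _ := by rw [mul_add]; gcongr

end RandomFunctional

section Deviation

variable {F : Type*} [NormedAddCommGroup F] [InnerProductSpace ℝ F] [FiniteDimensional ℝ F]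
  [MeasurableSpace F] [BorelSpace F] {ν : Measure F} [IsProbabilityMeasure ν]

lemma integral_measureReal_neg_halfspace_le {a : ℝ} (ha : 0 ≤ a) :
    ∫ θ, ν.real {x | x ≠ 0 ∧ a * ‖x‖ ≤ -⟪x, θ⟫} ∂(stdGaussian F) ≤ Real.exp (-(a ^ 2 / 2)) := by
  have hm : Measurable fun x : F => -x := measurable_neg
  have : IsProbabilityMeasure (ν.map fun x => -x) := Measure.isProbabilityMeasure_map hm.aemeasurable
  refine le_trans (le_of_eq ?_) (integral_measureReal_halfspace_le (ν := ν.map fun x => -x) ha)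
  congr 1
  ext θ
  rw [map_measureReal_apply hm]
  · simp
  · exact measurableSet_setOf_and (measurableSet_singleton (0 : F)).compl
      (measurableSet_le (by fun_prop) (by fun_prop))

lemma integrable_measureReal_cone {b a : ℝ} :
    Integrable (fun θ => ν.real {x | b ≤ ‖x‖ ∧ a * ‖x‖ ≤ ⟪x, θ⟫}) (stdGaussian F) ∧
    Measurable (fun θ => ν.real {x | b ≤ ‖x‖ ∧ a * ‖x‖ ≤ ⟪x, θ⟫}) := by
  have hR : MeasurableSet {z : F × F | b ≤ ‖z.2‖ ∧ a * ‖z.2‖ ≤ ⟪z.2, z.1⟫} :=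
    measurableSet_setOf_and (measurableSet_le (by fun_prop) (by fun_prop))
      (measurableSet_le (by fun_prop) (by fun_prop))
  exact ⟨integrable_measureReal_section (stdGaussian F) ν hR, measurable_measureReal_section ν hR⟩

lemma integrable_measureReal_halfspace {a : ℝ} :
    Integrable (fun θ => ν.real {x | x ≠ 0 ∧ a * ‖x‖ ≤ ⟪x, θ⟫}) (stdGaussian F) := by
  have hR : MeasurableSet {z : F × F | z.2 ≠ 0 ∧ a * ‖z.2‖ ≤ ⟪z.2, z.1⟫} :=
    measurableSet_setOf_and (measurable_snd (measurableSet_singleton (0 : F)).compl)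
      (measurableSet_le (by fun_prop) (by fun_prop))
  exact integrable_measureReal_section (stdGaussian F) ν hR

lemma integrable_measureReal_neg_halfspace {a : ℝ} :
    Integrable (fun θ => ν.real {x | x ≠ 0 ∧ a * ‖x‖ ≤ -⟪x, θ⟫}) (stdGaussian F) := by
  have hR : MeasurableSet {z : F × F | z.2 ≠ 0 ∧ a * ‖z.2‖ ≤ -⟪z.2, z.1⟫} :=
    measurableSet_setOf_and (measurable_snd (measurableSet_singleton (0 : F)).compl)
      (measurableSet_le (by fun_prop) (by fun_prop))
  exact integrable_measureReal_section (stdGaussian F) ν hR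

/-- If a random functional `⟪·, θ⟫` is large on a noticeable part of `{b ≤ ‖x‖}` and not too
negative on a large part of a ball, then log-concavity makes it large on a noticeable set. -/
lemma LogConcaveMeasure.half_exp_le_measureReal_halfspace (hν : LogConcaveMeasure ν) {M b a : ℝ}
    (hM : 0 < M) (hMb : 700 * M ≤ b) (ha : 0 < a) (hball : 3 / 4 ≤ ν.real {x | ‖x‖ ≤ 2 * M}) {θ : F}
    (hA : Real.exp (-(2 * a ^ 2)) ≤ ν.real {x | b ≤ ‖x‖ ∧ a * ‖x‖ ≤ ⟪x, θ⟫})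
    (hU : ν.real {x | x ≠ 0 ∧ a * ‖x‖ ≤ -⟪x, θ⟫} ≤ 1 / 4) :
    Real.exp (-(a ^ 2 / 50)) / 2 ≤ ν.real {x | x ≠ 0 ∧ a / 2 * ‖x‖ ≤ ⟪x, θ⟫} := by
  have hb : 0 < b := by linarith
  set A := {x | b ≤ ‖x‖ ∧ a * ‖x‖ ≤ ⟪x, θ⟫} with hA_def
  set U := {x | x ≠ 0 ∧ a * ‖x‖ ≤ -⟪x, θ⟫} with hU_def
  set B := {x : F | ‖x‖ ≤ 2 * M} with hB_def
  set D := {x | x ≠ 0 ∧ a / 2 * ‖x‖ ≤ ⟪x, θ⟫} with hD_def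
  have hAm : MeasurableSet A := measurableSet_setOf_and
    (measurableSet_le (by fun_prop) (by fun_prop)) (measurableSet_le (by fun_prop) (by fun_prop))
  have hUm : MeasurableSet U := measurableSet_setOf_and
    (measurableSet_singleton (0 : F)).compl (measurableSet_le (by fun_prop) (by fun_prop))
  have hDm : MeasurableSet D := measurableSet_setOf_and
    (measurableSet_singleton (0 : F)).compl (measurableSet_le (by fun_prop) (by fun_prop))
  have hBm : MeasurableSet B := measurableSet_le (by fun_prop) (by fun_prop)
  have hT : 1 / 2 ≤ ν.real (B \ U) := by
    have := le_measureReal_sdiff (μ := ν) (s₁ := B) (s₂ := U)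
    linarith
  set r := 7 * M / b with hr_def
  have hr0 : 0 < r := by positivity
  have hr1 : r ≤ 1 / 100 := by
    rw [hr_def, div_le_iff₀ hb]; linarith
  have hrb : r * b = 7 * M := by rw [hr_def]; field_simp
  have key := hν A (B \ U) D hAm (hBm.diff hUm) hDm r hr0 (by linarith) (by
    rintro x ⟨hx1, hx2⟩ y ⟨hy1, hy2⟩
    have hy3 : -(a * ‖y‖) ≤ ⟪y, θ⟫ := by
      by_cases hy : y = 0
      · simp [hy]
      · by_contra! h
        exact hy2 ⟨hy, by linarith⟩
    have hy1' : ‖y‖ ≤ 2 * M := hy1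
    have hw : 7 * M ≤ r * ‖x‖ := by rw [← hrb]; gcongr
    have h1 : r * (a * ‖x‖) ≤ r * ⟪x, θ⟫ := by gcongr
    have h2 : (1 - r) * -(a * ‖y‖) ≤ (1 - r) * ⟪y, θ⟫ :=
      mul_le_mul_of_nonneg_left hy3 (by linarith)
    have h3 : (1 - r) * (a * ‖y‖) ≤ 1 * (a * (2 * M)) := by gcongr; linarith
    have hin : ⟪r • x + (1 - r) • y, θ⟫ = r * ⟪x, θ⟫ + (1 - r) * ⟪y, θ⟫ := by
      rw [inner_add_left, real_inner_smul_left, real_inner_smul_left]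
    have hlow : a * (r * ‖x‖) - a * (2 * M) ≤ ⟪r • x + (1 - r) • y, θ⟫ := by
      rw [hin]; linarith
    have hnorm : ‖r • x + (1 - r) • y‖ ≤ r * ‖x‖ + 2 * M := by
      refine (norm_add_le _ _).trans ?_
      rw [norm_smul, norm_smul, Real.norm_of_nonneg hr0.le, Real.norm_of_nonneg (by linarith)]
      have : (1 - r) * ‖y‖ ≤ 1 * (2 * M) := by gcongr; linarith
      linarith
    have haw : a * (7 * M) ≤ a * (r * ‖x‖) := by gcongr
    have haM : 0 < a * M := by positivity
    refine ⟨fun h0 => ?_, ?_⟩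
    · rw [h0, inner_zero_left] at hlow
      linarith
    · have : a / 2 * ‖r • x + (1 - r) • y‖ ≤ a / 2 * (r * ‖x‖ + 2 * M) := by gcongr
      linarith)
  refine le_trans ?_ key
  have e1 : Real.exp (-(a ^ 2 / 50)) ≤ ν.real A ^ r := by
    calc Real.exp (-(a ^ 2 / 50)) ≤ Real.exp (-(2 * a ^ 2) * r) := by
          apply Real.exp_le_exp.2; nlinarith [sq_nonneg a]
      _ = Real.exp (-(2 * a ^ 2)) ^ r := Real.exp_mul _ _
      _ ≤ _ := by gcongr
  have e2 : (1 / 2 : ℝ) ≤ ν.real (B \ U) ^ (1 - r) := by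
    calc (1 / 2 : ℝ) = (1 / 2) ^ (1 : ℝ) := by simp
      _ ≤ (1 / 2) ^ (1 - r) :=
        Real.rpow_le_rpow_of_exponent_ge (by norm_num) (by norm_num) (by linarith)
      _ ≤ _ := by
        apply Real.rpow_le_rpow (by norm_num) hT (by linarith)
  calc Real.exp (-(a ^ 2 / 50)) / 2 = Real.exp (-(a ^ 2 / 50)) * (1 / 2) := by ring
    _ ≤ _ := by gcongr

/-- A log-concave vector with a noticeable large deviation of its norm has a direction with a
noticeable large deviation. -/
theorem LogConcaveMeasure.exists_inner_deviation (hν : LogConcaveMeasure ν) {M b a : ℝ}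
    (hM : 0 < M) (hMb : 700 * M ≤ b) (ha : 300 ≤ a) (hball : 3 / 4 ≤ ν.real {x | ‖x‖ ≤ 2 * M})
    (htail : Real.exp (-a ^ 2) ≤ ν.real {x | b ≤ ‖x‖}) :
    ∃ v : F, ‖v‖ = 1 ∧
      Real.exp (-a ^ 2) * ν.real {x | b ≤ ‖x‖} < ν.real {x | b / 100 ≤ ⟪v, x⟫} := by
  by_contra! hdir
  have hb : 0 < b := by linarith
  have ha0 : 0 < a := by linarith
  set s := ν.real {x | b ≤ ‖x‖} with hs_def
  have hs : 0 < s := (Real.exp_pos _).trans_le htail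
  set φ := (gaussianReal 0 1).real (Set.Ici a) with hφ_def
  have hφle : Real.exp (-((a + 1) ^ 2 / 2) - 1) ≤ φ := exp_le_gaussianReal_real_Ici ha0.le
  have hφ : 0 < φ := (Real.exp_pos _).trans_le hφle
  set f := fun θ : F => ν.real {x | b ≤ ‖x‖ ∧ a * ‖x‖ ≤ ⟪x, θ⟫} with hf_def
  set g := fun θ : F => ν.real {x | x ≠ 0 ∧ a * ‖x‖ ≤ -⟪x, θ⟫} with hg_def
  set h := fun θ : F => ν.real {x | x ≠ 0 ∧ a / 2 * ‖x‖ ≤ ⟪x, θ⟫} with hh_def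
  obtain ⟨hfi, hfm⟩ := integrable_measureReal_cone (ν := ν) (b := b) (a := a)
  have hfint : ∫ θ, f θ ∂(stdGaussian F) = s * φ := integral_measureReal_cone hb
  have hfi2 : Integrable (fun θ => f θ ^ 2) (stdGaussian F) :=
    Integrable.of_bound (hfm.pow_const 2).aestronglyMeasurable 1
      (Filter.Eventually.of_forall fun θ => by
        rw [Real.norm_of_nonneg (sq_nonneg _)]
        exact pow_le_one₀ measureReal_nonneg measureReal_le_one)
  have hf2 : ∫ θ, f θ ^ 2 ∂(stdGaussian F) ≤ s ^ 2 * (2 * Real.exp (-(a ^ 2 * (1 - 1 / 100)))) := by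
    refine (integral_sq_measureReal_cone_le hb ha0 (ε := 1 / 100) (δ := Real.exp (-a ^ 2))
      (by norm_num) fun v hv => ?_).trans ?_
    · rw [one_div_mul_eq_div]; exact hdir v hv
    · have : Real.exp (-a ^ 2) ≤ Real.exp (-(a ^ 2 * (1 - 1 / 100))) := by
        apply Real.exp_le_exp.2; nlinarith
      rw [two_mul]; gcongr
  set E := Real.exp (-(a ^ 2 / 50)) with hE_def
  have hE0 : 0 < E := Real.exp_pos _
  have hE1 : E ≤ 1 / 64 := by
    have h1 : E ≤ Real.exp (-6) := by apply Real.exp_le_exp.2; nlinarith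
    have h2 : Real.exp (-6) = (Real.exp 1 ^ 6)⁻¹ := by rw [← Real.exp_nat_mul, ← Real.exp_neg]; norm_num
    have h3 : (64 : ℝ) ≤ Real.exp 1 ^ 6 := by
      calc (64 : ℝ) = 2 ^ 6 := by norm_num
        _ ≤ _ := by gcongr; exact Real.exp_one_gt_two.le
    rw [h2] at h1
    exact h1.trans (by rw [one_div]; gcongr)
  have hpz : E / 8 ≤ (stdGaussian F).real {θ | s * φ / 2 ≤ f θ} := by
    have := sq_integral_div_le_measureReal (stdGaussian F) hfm hfi hfi2
      (by rw [hfint]; positivity) (by positivity) hf2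
    rw [hfint] at this
    refine le_trans ?_ this
    have e1 : (s * φ) ^ 2 / (4 * (s ^ 2 * (2 * Real.exp (-(a ^ 2 * (1 - 1 / 100)))))) =
        φ ^ 2 * Real.exp (a ^ 2 * (1 - 1 / 100)) / 8 := by
      rw [Real.exp_neg]; field_simp; norm_num
    rw [e1]
    gcongr
    calc E ≤ Real.exp (-((a + 1) ^ 2 / 2) - 1) ^ 2 * Real.exp (a ^ 2 * (1 - 1 / 100)) := by
          rw [← Real.exp_nat_mul, ← Real.exp_add]
          apply Real.exp_le_exp.2; push_cast; nlinarith
      _ ≤ _ := by gcongr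
  have hg : 1 / 4 * (stdGaussian F).real {θ | 1 / 4 ≤ g θ} ≤ E ^ 25 := by
    refine (mul_meas_ge_le_integral_of_nonneg
      (Filter.Eventually.of_forall fun _ => measureReal_nonneg)
      integrable_measureReal_neg_halfspace _).trans
      ((integral_measureReal_neg_halfspace_le ha0.le).trans ?_)
    rw [hE_def, ← Real.exp_nat_mul]
    apply Real.exp_le_exp.2; push_cast; linarith
  have hh : E / 2 * (stdGaussian F).real {θ | E / 2 ≤ h θ} ≤ E ^ 6 := by
    refine (mul_meas_ge_le_integral_of_nonneg
      (Filter.Eventually.of_forall fun _ => measureReal_nonneg)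
      integrable_measureReal_halfspace _).trans
      ((integral_measureReal_halfspace_le (by positivity)).trans ?_)
    rw [hE_def, ← Real.exp_nat_mul]
    apply Real.exp_le_exp.2; push_cast; nlinarith
  have hsub : {θ | s * φ / 2 ≤ f θ} \ {θ | 1 / 4 ≤ g θ} ⊆ {θ | E / 2 ≤ h θ} := by
    rintro θ ⟨h1, h2⟩
    refine hν.half_exp_le_measureReal_halfspace hM hMb ha0 hball (le_trans ?_ h1) (not_le.1 h2).le
    have hhalf : Real.exp (-1) ≤ 1 / 2 := by
      rw [Real.exp_neg, one_div]
      gcongr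
      exact Real.exp_one_gt_two.le
    calc Real.exp (-(2 * a ^ 2))
        ≤ Real.exp (-a ^ 2) * Real.exp (-((a + 1) ^ 2 / 2) - 1) * Real.exp (-1) := by
          rw [← Real.exp_add, ← Real.exp_add]
          apply Real.exp_le_exp.2; nlinarith
      _ ≤ s * φ * (1 / 2) := by gcongr
      _ = s * φ / 2 := by ring
  have hdiff := (le_measureReal_sdiff (μ := stdGaussian F) (s₁ := {θ | s * φ / 2 ≤ f θ})
    (s₂ := {θ | 1 / 4 ≤ g θ})).trans (measureReal_mono hsub)
  have hE25 : E ^ 25 ≤ E / 64 := by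
    calc E ^ 25 = E * E ^ 24 := by ring
      _ ≤ E * (1 / 64) ^ 24 := by gcongr
      _ ≤ E * (1 / 64) := by gcongr; norm_num
      _ = E / 64 := by ring
  have hE6 : E ^ 6 ≤ E * (E * (1 / 64) ^ 4) := by
    calc E ^ 6 = E * (E * E ^ 4) := by ring
      _ ≤ _ := by gcongr
  have : E / 2 * (E / 16) ≤ E / 2 * (stdGaussian F).real {θ | E / 2 ≤ h θ} := by
    gcongr; linarith
  nlinarith [mul_pos hE0 hE0]

end Deviation

section Moments

lemma measureReal_norm_le_of_integral_sq_le {F : Type*} [NormedAddCommGroup F] [MeasurableSpace F]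
    [OpensMeasurableSpace F] {ν : Measure F} [IsProbabilityMeasure ν] {M : ℝ} (hM : 0 < M)
    (hint : Integrable (fun x => ‖x‖ ^ 2) ν) (hle : ∫ x, ‖x‖ ^ 2 ∂ν ≤ M ^ 2) :
    3 / 4 ≤ ν.real {x | ‖x‖ ≤ 2 * M} := by
  have h1 := mul_meas_ge_le_integral_of_nonneg
    (Filter.Eventually.of_forall fun x : F => sq_nonneg ‖x‖) hint ((2 * M) ^ 2)
  have hm : MeasurableSet {x : F | ‖x‖ ≤ 2 * M} := measurableSet_le (by fun_prop) (by fun_prop)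
  have h2 : ν.real {x : F | ‖x‖ ≤ 2 * M}ᶜ ≤ ν.real {x : F | (2 * M) ^ 2 ≤ ‖x‖ ^ 2} := by
    refine measureReal_mono fun x hx => ?_
    have : 2 * M < ‖x‖ := not_le.1 hx
    exact pow_le_pow_left₀ (by positivity) this.le 2
  rw [probReal_compl_eq_one_sub hm] at h2
  have h3 : M ^ 2 * (4 * ν.real {x : F | (2 * M) ^ 2 ≤ ‖x‖ ^ 2}) ≤ M ^ 2 * 1 := by linarith
  have h4 := le_of_mul_le_mul_left h3 (by positivity)
  linarith

/-- Borell's lemma: a log-concave measure has exponential tails. -/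
lemma LogConcaveMeasure.measureReal_lt_norm_le {F : Type*} [NormedAddCommGroup F]
    [NormedSpace ℝ F] [MeasurableSpace F] [OpensMeasurableSpace F] {ν : Measure F}
    [IsProbabilityMeasure ν] (hν : LogConcaveMeasure ν) {R : ℝ} (hR : 0 < R)
    (hball : 3 / 4 ≤ ν.real {x | ‖x‖ ≤ R}) {t : ℝ} (ht : 0 < t) :
    ν.real {x | t < ‖x‖} ≤ Real.exp 1 * Real.exp (-(1 / (2 * R)) * t) := by
  rcases le_or_gt t R with htR | htR
  · refine measureReal_le_one.trans ?_
    rw [← Real.exp_add, Real.one_le_exp_iff]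
    have : 1 / (2 * R) * t ≤ 1 := by
      rw [div_mul_eq_mul_div, div_le_one (by positivity)]; linarith
    linarith
  set S := {x : F | t < ‖x‖} with hS_def
  set B := {x : F | ‖x‖ ≤ R} with hB_def
  have hm : MeasurableSet S := measurableSet_lt (by fun_prop) (by fun_prop)
  have hB : MeasurableSet B := measurableSet_le (by fun_prop) (by fun_prop)
  set a := 2 * R / (t + R) with ha_def
  have ha0 : 0 < a := by positivity
  have ha1 : a < 1 := by rw [ha_def, div_lt_one (by positivity)]; linarith
  have hat : a * (t + R) = 2 * R := by rw [ha_def]; field_simp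
  have key := hν S B Bᶜ hm hB hB.compl a ha0 ha1 (by
    intro x hx y hy
    have hx' : t < ‖x‖ := hx
    have hy' : ‖y‖ ≤ R := hy
    refine (not_le (a := ‖a • x + (1 - a) • y‖)).2 ?_
    have h1 : ‖a • x‖ ≤ ‖a • x + (1 - a) • y‖ + ‖(1 - a) • y‖ := by
      simpa using norm_sub_le (a • x + (1 - a) • y) ((1 - a) • y)
    rw [norm_smul a, norm_smul (1 - a), Real.norm_of_nonneg ha0.le,
      Real.norm_of_nonneg (by linarith)] at h1
    have h2 : a * t < a * ‖x‖ := by gcongr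
    have h3 : (1 - a) * ‖y‖ ≤ (1 - a) * R := mul_le_mul_of_nonneg_left hy' (by linarith)
    linarith)
  have hc : ν.real Bᶜ ≤ 1 / 4 := by rw [probReal_compl_eq_one_sub hB]; linarith
  have hS0 : 0 ≤ ν.real S := measureReal_nonneg
  have h1 : ν.real S ^ a * (3 / 4) ≤ 1 / 4 := by
    refine le_trans ?_ (key.trans hc)
    gcongr
    calc (3 / 4 : ℝ) = (3 / 4) ^ (1 : ℝ) := by simp
      _ ≤ (3 / 4) ^ (1 - a) :=
        Real.rpow_le_rpow_of_exponent_ge (by norm_num) (by norm_num) (by linarith)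
      _ ≤ _ := Real.rpow_le_rpow (by norm_num) hball (by linarith)
  have he : (1 / 3 : ℝ) ≤ Real.exp (-1) := by
    rw [Real.exp_neg, one_div]
    gcongr
    exact (Real.exp_one_lt_d9.trans (by norm_num)).le
  have h2 : ν.real S ^ a ≤ Real.exp (-1) := by linarith
  have h3 : ν.real S ≤ Real.exp (-1) ^ a⁻¹ := by
    have := Real.rpow_le_rpow (Real.rpow_nonneg hS0 a) h2 (inv_nonneg.2 ha0.le)
    rwa [Real.rpow_rpow_inv hS0 ha0.ne'] at this
  refine h3.trans ?_
  rw [← Real.exp_mul, ← Real.exp_add]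
  apply Real.exp_le_exp.2
  have h4 : a⁻¹ = 1 / (2 * R) * t + 1 / 2 := by rw [ha_def]; field_simp
  rw [h4]
  linarith

lemma integrable_rpow_of_measureReal_lt_le {α : Type*} [MeasurableSpace α] {ν : Measure α}
    [IsProbabilityMeasure ν] {f : α → ℝ} (hf : Measurable f) (hf0 : ∀ x, 0 ≤ f x) {A c : ℝ}
    (hc : 0 < c) (htail : ∀ t, 0 < t → ν.real {x | t < f x} ≤ A * Real.exp (-c * t)) {p : ℝ}
    (hp : 0 < p) : Integrable (fun x => f x ^ p) ν := by
  refine ⟨(hf.pow_const p).aestronglyMeasurable, ?_⟩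
  rw [hasFiniteIntegral_iff_ofReal (Filter.Eventually.of_forall fun x => Real.rpow_nonneg (hf0 x) p),
    lintegral_rpow_eq_lintegral_meas_lt_mul ν (Filter.Eventually.of_forall hf0) hf.aemeasurable hp]
  refine ENNReal.mul_lt_top ENNReal.ofReal_lt_top ?_
  have hint : IntegrableOn (fun t : ℝ => A * (t ^ (p - 1) * Real.exp (-c * t ^ (1 : ℝ))))
      (Set.Ioi 0) :=
    (integrableOn_rpow_mul_exp_neg_mul_rpow (by linarith) one_pos hc).const_mul A
  refine lt_of_le_of_lt (lintegral_mono_ae ?_) hint.lintegral_lt_top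
  filter_upwards [self_mem_ae_restrict measurableSet_Ioi] with t ht
  have ht0 : (0 : ℝ) < t := ht
  rw [← ofReal_measureReal, ← ENNReal.ofReal_mul measureReal_nonneg]
  apply ENNReal.ofReal_le_ofReal
  rw [Real.rpow_one]
  calc _ ≤ A * Real.exp (-c * t) * t ^ (p - 1) := by gcongr; exact htail t ht0
    _ = _ := by ring

lemma LogConcaveMeasure.integrable_norm_rpow {F : Type*} [NormedAddCommGroup F]
    [NormedSpace ℝ F] [MeasurableSpace F] [OpensMeasurableSpace F] {ν : Measure F}
    [IsProbabilityMeasure ν] (hν : LogConcaveMeasure ν) {R : ℝ} (hR : 0 < R)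
    (hball : 3 / 4 ≤ ν.real {x | ‖x‖ ≤ R}) {p : ℝ} (hp : 0 < p) :
    Integrable (fun x => ‖x‖ ^ p) ν :=
  integrable_rpow_of_measureReal_lt_le measurable_norm (fun x => norm_nonneg x) (by positivity)
    (fun _ ht => hν.measureReal_lt_norm_le hR hball ht) hp

variable {n : ℕ} {μ : Measure Ω} {X : Ω → EuclideanSpace ℝ (Fin n)}

lemma sigmaX_nonneg (p : ℝ) : 0 ≤ sigmaX μ X p :=
  Real.iSup_nonneg fun _ => Real.rpow_nonneg
    (integral_nonneg fun _ => Real.rpow_nonneg (abs_nonneg _) _) _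

lemma abs_inner_rpow_le {t : EuclideanSpace ℝ (Fin n)} (ht : ‖t‖ = 1) {p : ℝ} (hp : 0 < p)
    (x : EuclideanSpace ℝ (Fin n)) : |⟪t, x⟫| ^ p ≤ ‖x‖ ^ p := by
  refine Real.rpow_le_rpow (abs_nonneg _) ?_ hp.le
  simpa [ht] using abs_real_inner_le_norm t x

lemma integrable_abs_inner_rpow (hX : Measurable X) {p : ℝ} (hp : 0 < p)
    (hint : Integrable (fun ω => ‖X ω‖ ^ p) μ) {t : EuclideanSpace ℝ (Fin n)} (ht : ‖t‖ = 1) :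
    Integrable (fun ω => |⟪t, X ω⟫| ^ p) μ := by
  refine hint.mono' ?_ (Filter.Eventually.of_forall fun ω => ?_)
  · exact Measurable.aestronglyMeasurable (by fun_prop)
  · rw [Real.norm_of_nonneg (Real.rpow_nonneg (abs_nonneg _) _)]
    exact abs_inner_rpow_le ht hp _

lemma integral_abs_inner_rpow_le_sigmaX (hX : Measurable X) {p : ℝ} (hp : 0 < p)
    (hint : Integrable (fun ω => ‖X ω‖ ^ p) μ) {t : EuclideanSpace ℝ (Fin n)} (ht : ‖t‖ = 1) :
    (∫ ω, |⟪t, X ω⟫| ^ p ∂μ) ≤ sigmaX μ X p ^ p := by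
  have hnn : ∀ v : EuclideanSpace ℝ (Fin n), 0 ≤ ∫ ω, |⟪v, X ω⟫| ^ p ∂μ :=
    fun v => integral_nonneg fun _ => Real.rpow_nonneg (abs_nonneg _) _
  have hbdd : BddAbove (Set.range fun v : {v : EuclideanSpace ℝ (Fin n) // ‖v‖ = 1} =>
      (∫ ω, |⟪v.1, X ω⟫| ^ p ∂μ) ^ (1 / p)) := by
    refine ⟨(∫ ω, ‖X ω‖ ^ p ∂μ) ^ (1 / p), ?_⟩
    rintro _ ⟨v, rfl⟩
    exact Real.rpow_le_rpow (hnn v)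
      (integral_mono (integrable_abs_inner_rpow hX hp hint v.2) hint
        fun ω => abs_inner_rpow_le v.2 hp _) (by positivity)
  calc (∫ ω, |⟪t, X ω⟫| ^ p ∂μ) = ((∫ ω, |⟪t, X ω⟫| ^ p ∂μ) ^ (1 / p)) ^ p := by
        rw [one_div, Real.rpow_inv_rpow (hnn t) hp.ne']
    _ ≤ sigmaX μ X p ^ p :=
        Real.rpow_le_rpow (Real.rpow_nonneg (hnn t) _) (le_ciSup hbdd ⟨t, ht⟩) hp.le

lemma measureReal_le_inner_le (hX : Measurable X) {p : ℝ} (hp : 0 < p)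
    (hint : Integrable (fun ω => ‖X ω‖ ^ p) μ) [IsFiniteMeasure μ] {t : EuclideanSpace ℝ (Fin n)}
    (ht : ‖t‖ = 1) {r : ℝ} (hr : 0 < r) : μ.real {ω | r ≤ ⟪t, X ω⟫} ≤ (sigmaX μ X p / r) ^ p := by
  have h1 := mul_meas_ge_le_integral_of_nonneg
    (Filter.Eventually.of_forall fun ω => Real.rpow_nonneg (abs_nonneg ⟪t, X ω⟫) p)
    (integrable_abs_inner_rpow hX hp hint ht) (r ^ p)
  rw [Real.div_rpow (sigmaX_nonneg p) hr.le, le_div_iff₀ (Real.rpow_pos_of_pos hr p), mul_comm]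
  refine le_trans ?_ (h1.trans (integral_abs_inner_rpow_le_sigmaX hX hp hint ht))
  refine mul_le_mul_of_nonneg_left (measureReal_mono fun ω hω => ?_) (by positivity)
  have hω' : r ≤ ⟪t, X ω⟫ := hω
  exact Real.rpow_le_rpow hr.le (hω'.trans (le_abs_self _)) hp.le

end Moments

section NullSets

open Filter Topology

variable {F : Type*} [NormedAddCommGroup F] [NormedSpace ℝ F] [MeasurableSpace F]
  [BorelSpace F] {ν : Measure F} [IsProbabilityMeasure ν]

lemma LogConcaveMeasure.convex_support (hν : LogConcaveMeasure ν) : Convex ℝ ν.support := by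
  rw [convex_iff_forall_pos]
  intro x hx y hy a b ha hb hab
  obtain rfl : b = 1 - a := by linarith
  rw [Metric.nhds_basis_ball.mem_measureSupport] at hx hy ⊢
  intro ε hε
  have hpos : ∀ z : F, 0 < ν (Metric.ball z ε) → 0 < ν.real (Metric.ball z ε) :=
    fun z hz => ENNReal.toReal_pos hz.ne' (measure_ne_top _ _)
  have key := hν (Metric.ball x ε) (Metric.ball y ε) (Metric.ball (a • x + (1 - a) • y) ε)
    Metric.isOpen_ball.measurableSet Metric.isOpen_ball.measurableSet
    Metric.isOpen_ball.measurableSet a ha (by linarith) (by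
      intro x' hx' y' hy'
      rw [mem_ball_iff_norm] at hx' hy' ⊢
      have h1 : a • x' + (1 - a) • y' - (a • x + (1 - a) • y) =
          a • (x' - x) + (1 - a) • (y' - y) := by module
      rw [h1]
      refine (norm_add_le _ _).trans_lt ?_
      rw [norm_smul, norm_smul, Real.norm_of_nonneg ha.le, Real.norm_of_nonneg hb.le]
      nlinarith)
  have h0 := hpos x (hx ε hε)
  have h1 := hpos y (hy ε hε)
  have h2 : 0 < ν.real (Metric.ball (a • x + (1 - a) • y) ε) :=
    lt_of_lt_of_le (mul_pos (Real.rpow_pos_of_pos h0 _) (Real.rpow_pos_of_pos h1 _)) key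
  exact (ENNReal.toReal_pos_iff.1 h2).1

variable [FiniteDimensional ℝ F]

/-- A compact set that is left by moving towards a set of positive measure is null. -/
lemma LogConcaveMeasure.measureReal_eq_zero_of_isCompact (hν : LogConcaveMeasure ν) {P L : Set F}
    (hP : IsCompact P) (hL : IsCompact L) (hL0 : 0 < ν.real L)
    (hout : ∀ a : ℝ, 0 < a → a < 1 → ∀ x ∈ P, ∀ y ∈ L, a • x + (1 - a) • y ∉ P) :
    ν.real P = 0 := by
  by_contra hne
  have hP0 : 0 < ν.real P := lt_of_le_of_ne measureReal_nonneg (Ne.symm hne)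
  have : ProperSpace F := FiniteDimensional.proper ℝ F
  obtain ⟨r, hr⟩ := (hP.union hL).isBounded.exists_norm_le
  have key : ∀ δ : ℝ, 0 < δ → ν.real P ≤ ν.real (Metric.cthickening δ P) - ν.real P := by
    intro δ hδ
    have hlim : Tendsto (fun a : ℝ => ν.real P ^ a * ν.real L ^ (1 - a)) (𝓝[<] 1)
        (𝓝 (ν.real P)) := by
      have hc : Continuous fun a : ℝ => ν.real P ^ a * ν.real L ^ (1 - a) :=
        (Real.continuous_const_rpow hP0.ne').mul
          ((Real.continuous_const_rpow hL0.ne').comp (by fun_prop))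
      have := (hc.tendsto 1).mono_left (nhdsWithin_le_nhds (s := Set.Iio 1))
      simpa using this
    have hsmall : ∀ᶠ a : ℝ in 𝓝[<] 1, (1 - a) * (2 * r) < δ := by
      have hc : Continuous fun a : ℝ => (1 - a) * (2 * r) := by fun_prop
      have := (hc.tendsto 1).mono_left (nhdsWithin_le_nhds (s := Set.Iio 1))
      exact this.eventually_lt_const (by simpa using hδ)
    have hpos : ∀ᶠ a : ℝ in 𝓝[<] 1, 0 < a :=
      (eventually_gt_nhds one_pos).filter_mono nhdsWithin_le_nhds
    refine le_of_tendsto hlim ?_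
    filter_upwards [hsmall, hpos, self_mem_nhdsWithin] with a ha1 ha0 ha2
    have ha2' : a < 1 := ha2
    have hsub : P ⊆ Metric.cthickening δ P := Metric.self_subset_cthickening P
    rw [← measureReal_sdiff hsub hP.measurableSet]
    refine hν P L _ hP.measurableSet hL.measurableSet
      (Metric.isClosed_cthickening.measurableSet.diff hP.measurableSet) a ha0 ha2'
      fun x hx y hy => ⟨?_, hout a ha0 ha2' x hx y hy⟩
    refine Metric.mem_cthickening_of_dist_le _ x _ _ hx ?_
    have h1 : a • x + (1 - a) • y - x = (1 - a) • (y - x) := by module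
    rw [dist_eq_norm, h1, norm_smul, Real.norm_of_nonneg (by linarith)]
    have h2 : ‖y - x‖ ≤ 2 * r := by
      have := norm_sub_le y x
      have := hr x (Or.inl hx)
      have := hr y (Or.inr hy)
      linarith
    exact (mul_le_mul_of_nonneg_left h2 (by linarith)).trans ha1.le
  have hlim : Tendsto (fun δ : ℝ => ν.real (Metric.cthickening δ P) - ν.real P) (𝓝[>] 0)
      (𝓝 (ν.real P - ν.real P)) :=
    (((ENNReal.tendsto_toReal (measure_ne_top ν P)).comp
      (tendsto_measure_cthickening_of_isCompact hP)).mono_left nhdsWithin_le_nhds).sub_const _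
  have := ge_of_tendsto hlim (by
    filter_upwards [self_mem_nhdsWithin] with δ hδ using key δ hδ)
  linarith

lemma LogConcaveMeasure.measureReal_eq_zero_of_combo_notMem (hν : LogConcaveMeasure ν)
    {P L : Set F} (hP : MeasurableSet P) (hL : MeasurableSet L) (hL0 : 0 < ν.real L)
    (hout : ∀ a : ℝ, 0 < a → a < 1 → ∀ x ∈ P, ∀ y ∈ L, a • x + (1 - a) • y ∉ P) :
    ν.real P = 0 := by
  by_contra hne
  have hP0 : 0 < ν.real P := lt_of_le_of_ne measureReal_nonneg (Ne.symm hne)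
  obtain ⟨P', hP', hPc, hP1⟩ := exists_isCompact_mul_lt_measureReal ν hP hP0 le_rfl zero_lt_one
  obtain ⟨L', hL', hLc, hL1⟩ := exists_isCompact_mul_lt_measureReal ν hL hL0 le_rfl zero_lt_one
  rw [zero_mul] at hP1 hL1
  exact hP1.ne' (hν.measureReal_eq_zero_of_isCompact hPc hLc hL1
    fun a ha0 ha1 x hx y hy h => hout a ha0 ha1 x (hP' hx) y (hL' hy) (hP' h))

lemma LogConcaveMeasure.measureReal_hyperplane (hν : LogConcaveMeasure ν) (f : StrongDual ℝ F)
    (c : ℝ) (hf : ¬ ∀ᵐ x ∂ν, f x = c) : ν.real {x | f x = c} = 0 := by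
  have hm : MeasurableSet {x | f x = c} := f.continuous.measurable (measurableSet_singleton c)
  refine hν.measureReal_eq_zero_of_combo_notMem hm hm.compl
    (lt_of_le_of_ne measureReal_nonneg fun h => hf ?_) ?_
  · rw [ae_iff]
    exact (measureReal_eq_zero_iff (measure_ne_top _ _)).1 h.symm
  · intro a ha0 ha1 x hx y hy h
    have hx' : f x = c := hx
    have h' : f (a • x + (1 - a) • y) = c := h
    refine hy ?_
    simp only [map_add, map_smul, smul_eq_mul, hx'] at h'
    have h2 : (1 - a) * f y = (1 - a) * c := by linarith
    exact mul_left_cancel₀ (by linarith) h2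

/-- A nondegenerate log-concave measure does not charge the boundary of a convex set. -/
lemma LogConcaveMeasure.measureReal_frontier_eq_zero (hν : LogConcaveMeasure ν)
    (hH : ∀ f : StrongDual ℝ F, f ≠ 0 → ∀ c, ν.real {x | f x = c} = 0) {K : Set F}
    (hK : Convex ℝ K) : ν.real (frontier K) = 0 := by
  have hnull : ∀ S : Set F, ∀ f : StrongDual ℝ F, f ≠ 0 → ∀ c, S ⊆ {x | f x = c} → ν.real S = 0 :=
    fun S f hf c hS => le_antisymm ((measureReal_mono hS).trans_eq (hH f hf c)) measureReal_nonneg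
  rcases K.eq_empty_or_nonempty with rfl | ⟨x₀, hx₀⟩
  · simp
  by_cases hint : (interior K).Nonempty
  swap
  · rw [hK.interior_nonempty_iff_affineSpan_eq_top] at hint
    have hdir : (affineSpan ℝ K).direction < ⊤ := by
      rw [lt_top_iff_ne_top]
      intro h
      exact hint ((AffineSubspace.direction_eq_top_iff_of_nonempty
        ⟨x₀, subset_affineSpan ℝ K hx₀⟩).1 h)
    obtain ⟨g, hg0, hg⟩ := Submodule.exists_le_ker_of_lt_top _ hdir
    refine hnull _ (LinearMap.toContinuousLinearMap g) (by simpa using hg0) (g x₀) ?_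
    have hcl : IsClosed {x | LinearMap.toContinuousLinearMap g x = g x₀} :=
      isClosed_eq (by fun_prop) continuous_const
    refine frontier_subset_closure.trans (closure_minimal (fun x hx => ?_) hcl)
    have : g (x -ᵥ x₀) = 0 := hg (AffineSubspace.vsub_mem_direction
      (subset_affineSpan ℝ K hx) (subset_affineSpan ℝ K hx₀))
    rw [vsub_eq_sub, map_sub, sub_eq_zero] at this
    exact this
  rcases (measureReal_nonneg (μ := ν) (s := interior K)).eq_or_lt with h0 | hpos
  · have h0' : ν (interior K) = 0 := (measureReal_eq_zero_iff (measure_ne_top _ _)).1 h0.symm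
    have hdisj : Disjoint (interior K) ν.support :=
      Set.disjoint_left.2 fun x hx =>
        Measure.subset_compl_support_of_isOpen isOpen_interior h0' hx
    obtain ⟨f, c, hf1, hf2⟩ := geometric_hahn_banach_open hK.interior isOpen_interior
      hν.convex_support hdisj
    obtain ⟨y, hy⟩ := hint
    obtain ⟨z, hz⟩ := Measure.nonempty_support (IsProbabilityMeasure.ne_zero ν)
    have hf : f ≠ 0 := by
      rintro rfl
      have h1 := hf1 y hy
      have h2 := hf2 z hz
      simp only [zero_apply] at h1 h2
      linarith
    have hcl : closure K ⊆ {x | f x ≤ c} := by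
      rw [← hK.closure_interior_eq_closure_of_nonempty_interior ⟨y, hy⟩]
      exact closure_minimal (fun x hx => (hf1 x hx).le)
        (isClosed_le f.continuous continuous_const)
    have hsub : frontier K ⊆ {x | f x = c} ∪ ν.supportᶜ := by
      intro x hx
      by_cases hxs : x ∈ ν.support
      · exact Or.inl (le_antisymm (hcl (frontier_subset_closure hx)) (hf2 x hxs))
      · exact Or.inr hxs
    have hs : ν.real ν.supportᶜ = 0 := by
      rw [measureReal_def, Measure.measure_compl_support]; simp
    refine le_antisymm ((measureReal_mono hsub).trans ((measureReal_union_le _ _).trans ?_))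
      measureReal_nonneg
    rw [hH f hf c, hs, add_zero]
  · refine hν.measureReal_eq_zero_of_combo_notMem isClosed_frontier.measurableSet
      isOpen_interior.measurableSet hpos fun a ha0 ha1 x hx y hy h => h.2 ?_
    exact hK.combo_closure_interior_mem_interior (frontier_subset_closure hx) hy ha0.le
      (by linarith) (by ring)

end NullSets

section Isotropic

variable {n : ℕ} {μ : Measure Ω} {X : Ω → EuclideanSpace ℝ (Fin n)}

lemma IsIsotropic.integrable_mul_self (h : IsIsotropic μ X) (i : Fin n) :
    Integrable (fun ω => X ω i * X ω i) μ := by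
  by_contra hne
  have := h.2 i i
  rw [integral_undef hne] at this
  simp at this

lemma IsIsotropic.memLp (h : IsIsotropic μ X) (hX : Measurable X) (i : Fin n) :
    MemLp (fun ω => X ω i) 2 μ := by
  have hm : Measurable fun ω => X ω i := by fun_prop
  rw [memLp_two_iff_integrable_sq hm.aestronglyMeasurable]
  simpa only [sq] using h.integrable_mul_self i

lemma inner_eq_sum_mul (v x : EuclideanSpace ℝ (Fin n)) : ⟪v, x⟫ = ∑ i, v i * x i := by
  simp [PiLp.inner_apply, mul_comm]

lemma IsIsotropic.integral_inner [IsProbabilityMeasure μ] (h : IsIsotropic μ X)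
    (hX : Measurable X) (v : EuclideanSpace ℝ (Fin n)) : ∫ ω, ⟪v, X ω⟫ ∂μ = 0 := by
  simp_rw [inner_eq_sum_mul]
  rw [integral_finsetSum _ fun i _ => ((h.memLp hX i).integrable one_le_two).const_mul (v i)]
  simp [integral_const_mul, h.1]

lemma IsIsotropic.integral_inner_sq (h : IsIsotropic μ X)
    (hX : Measurable X) (v : EuclideanSpace ℝ (Fin n)) : ∫ ω, ⟪v, X ω⟫ ^ 2 ∂μ = ‖v‖ ^ 2 := by
  have hint : ∀ i j, Integrable (fun ω => v i * v j * (X ω i * X ω j)) μ := fun i j =>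
    ((h.memLp hX i).integrable_mul (h.memLp hX j)).const_mul _
  have hexp : ∀ x : EuclideanSpace ℝ (Fin n),
      ⟪v, x⟫ ^ 2 = ∑ i, ∑ j, v i * v j * (x i * x j) := by
    intro x
    rw [inner_eq_sum_mul, sq, Finset.sum_mul_sum]
    refine Finset.sum_congr rfl fun i _ => Finset.sum_congr rfl fun j _ => ?_
    ring
  simp_rw [hexp]
  rw [integral_finsetSum _ fun i _ => integrable_finsetSum _ fun j _ => hint i j]
  simp_rw [integral_finsetSum _ fun j _ => hint _ j, integral_const_mul, h.2]
  simp [EuclideanSpace.real_norm_sq_eq, ← sq]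

lemma IsIsotropic.measureReal_hyperplane [IsProbabilityMeasure μ] (h : IsIsotropic μ X)
    (hX : Measurable X) (hν : LogConcaveMeasure (μ.map X))
    (f : StrongDual ℝ (EuclideanSpace ℝ (Fin n))) (hf : f ≠ 0) (c : ℝ) :
    (μ.map X).real {x | f x = c} = 0 := by
  have : IsProbabilityMeasure (μ.map X) := Measure.isProbabilityMeasure_map hX.aemeasurable
  refine hν.measureReal_hyperplane f c fun hae => hf ?_
  obtain ⟨v, rfl⟩ := (InnerProductSpace.toDual ℝ (EuclideanSpace ℝ (Fin n))).surjective f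
  have hae' : ∀ᵐ ω ∂μ, ⟪v, X ω⟫ = c := by
    simpa using ae_of_ae_map hX.aemeasurable hae
  have hc : c = 0 := by
    have := h.integral_inner hX v
    rw [integral_congr_ae hae'] at this
    simpa using this
  have hv : ‖v‖ ^ 2 = 0 := by
    rw [← h.integral_inner_sq hX v, ← integral_zero Ω ℝ (μ := μ)]
    refine integral_congr_ae ?_
    filter_upwards [hae'] with ω hω
    rw [hω, hc]; simp
  have : v = 0 := by simpa using hv
  simp [this]

/-- The orthogonal projection onto the span of the coordinate vectors indexed by `I`. -/
def coordProj (I : Finset (Fin n)) : EuclideanSpace ℝ (Fin n) →ₗ[ℝ] EuclideanSpace ℝ (Fin n) where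
  toFun x := WithLp.toLp 2 fun i => if i ∈ I then x i else 0
  map_add' x y := by ext i; by_cases hi : i ∈ I <;> simp [hi]
  map_smul' c x := by ext i; by_cases hi : i ∈ I <;> simp [hi]

lemma coordProj_apply (I : Finset (Fin n)) (x : EuclideanSpace ℝ (Fin n)) (i : Fin n) :
    coordProj I x i = if i ∈ I then x i else 0 := rfl

lemma coordProj_univ (x : EuclideanSpace ℝ (Fin n)) : coordProj Finset.univ x = x := by
  ext i; simp [coordProj_apply]

lemma measurable_coordProj (I : Finset (Fin n)) : Measurable (coordProj I) :=
  (LinearMap.continuous_of_finiteDimensional _).measurable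

lemma norm_coordProj_sq (I : Finset (Fin n)) (x : EuclideanSpace ℝ (Fin n)) :
    ‖coordProj I x‖ ^ 2 = ∑ i ∈ I, x i ^ 2 := by
  simp [EuclideanSpace.real_norm_sq_eq, coordProj_apply, ite_pow]

lemma norm_coordProj_le (I : Finset (Fin n)) (x : EuclideanSpace ℝ (Fin n)) :
    ‖coordProj I x‖ ≤ ‖x‖ := by
  refine pow_le_pow_iff_left₀ (norm_nonneg _) (norm_nonneg _) two_ne_zero |>.1 ?_
  rw [norm_coordProj_sq, EuclideanSpace.real_norm_sq_eq]
  exact Finset.sum_le_sum_of_subset_of_nonneg (Finset.subset_univ _) fun _ _ _ => sq_nonneg _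

lemma inner_coordProj (I : Finset (Fin n)) (v x : EuclideanSpace ℝ (Fin n)) :
    ⟪v, coordProj I x⟫ = ⟪coordProj I v, x⟫ := by
  rw [inner_eq_sum_mul, inner_eq_sum_mul]
  refine Finset.sum_congr rfl fun i _ => ?_
  by_cases hi : i ∈ I <;> simp [coordProj_apply, hi]

lemma IsIsotropic.integral_norm_coordProj_sq (h : IsIsotropic μ X) (hX : Measurable X)
    (I : Finset (Fin n)) :
    Integrable (fun ω => ‖coordProj I (X ω)‖ ^ 2) μ ∧
      ∫ ω, ‖coordProj I (X ω)‖ ^ 2 ∂μ = I.card := by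
  simp_rw [norm_coordProj_sq]
  have hint : ∀ i ∈ I, Integrable (fun ω => X ω i ^ 2) μ := fun i _ =>
    (h.memLp hX i).integrable_sq
  refine ⟨integrable_finsetSum _ hint, ?_⟩
  rw [integral_finsetSum _ hint]
  have : ∀ i, ∫ ω, X ω i ^ 2 ∂μ = 1 := fun i => by simpa [sq] using h.2 i i
  simp [this]

lemma IsIsotropic.measureReal_norm_coordProj_le [IsProbabilityMeasure μ] (h : IsIsotropic μ X)
    (hX : Measurable X) (I : Finset (Fin n)) {M : ℝ} (hM : 0 < M) (hI : (I.card : ℝ) ≤ M ^ 2) :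
    3 / 4 ≤ ((μ.map X).map (coordProj I)).real {x | ‖x‖ ≤ 2 * M} := by
  have hm := measurable_coordProj I
  have : IsProbabilityMeasure (μ.map X) := Measure.isProbabilityMeasure_map hX.aemeasurable
  have : IsProbabilityMeasure ((μ.map X).map (coordProj I)) :=
    Measure.isProbabilityMeasure_map hm.aemeasurable
  obtain ⟨h1, h2⟩ := h.integral_norm_coordProj_sq hX I
  have hsm : ∀ ρ : Measure (EuclideanSpace ℝ (Fin n)),
      AEStronglyMeasurable (fun x : EuclideanSpace ℝ (Fin n) => ‖x‖ ^ 2) ρ := fun ρ =>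
    Measurable.aestronglyMeasurable (by fun_prop)
  rw [Measure.map_map hm hX] at *
  refine measureReal_norm_le_of_integral_sq_le hM ?_ ?_
  · exact (integrable_map_measure (hsm _) (hm.comp hX).aemeasurable).2 h1
  · rw [integral_map (hm.comp hX).aemeasurable (hsm _)]
    exact h2.trans_le hI

lemma IsIsotropic.integrable_norm_rpow [IsProbabilityMeasure μ] (h : IsIsotropic μ X)
    (hX : Measurable X) (hν : LogConcaveMeasure (μ.map X)) {p : ℝ} (hp : 0 < p) :
    Integrable (fun ω => ‖X ω‖ ^ p) μ := by
  have : IsProbabilityMeasure (μ.map X) := Measure.isProbabilityMeasure_map hX.aemeasurable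
  have hball := h.measureReal_norm_coordProj_le hX Finset.univ (M := n + 1) (by positivity)
    (by rw [Finset.card_univ, Fintype.card_fin]; nlinarith [Nat.cast_nonneg (α := ℝ) n])
  have hid : ⇑(coordProj (Finset.univ : Finset (Fin n))) = id := funext coordProj_univ
  rw [hid, Measure.map_id] at hball
  have := hν.integrable_norm_rpow (by positivity) hball hp
  exact (integrable_map_measure (Measurable.aestronglyMeasurable (by fun_prop))
    hX.aemeasurable).1 this

lemma measureReal_le_inner_le_of_norm_le_one [IsFiniteMeasure μ] (hX : Measurable X) {p : ℝ}
    (hp : 0 < p) (hint : Integrable (fun ω => ‖X ω‖ ^ p) μ) {t : EuclideanSpace ℝ (Fin n)}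
    (ht : ‖t‖ ≤ 1) {r : ℝ} (hr : 0 < r) :
    μ.real {ω | r ≤ ⟪t, X ω⟫} ≤ (sigmaX μ X p / r) ^ p := by
  by_cases h0 : t = 0
  · have : {ω | r ≤ ⟪t, X ω⟫} = ∅ := by
      ext ω; simp [h0, hr]
    rw [this, measureReal_empty]
    exact Real.rpow_nonneg (div_nonneg (sigmaX_nonneg p) hr.le) _
  · have hpos : 0 < ‖t‖ := norm_pos_iff.2 h0
    refine le_trans (measureReal_mono fun ω hω => ?_)
      (measureReal_le_inner_le hX hp hint (t := ‖t‖⁻¹ • t) ?_ hr)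
    · have hω' : r ≤ ⟪t, X ω⟫ := hω
      have h1 : 1 ≤ ‖t‖⁻¹ := (one_le_inv₀ hpos).2 ht
      simp only [Set.mem_ofPred_eq, real_inner_smul_left]
      nlinarith
    · rw [norm_smul]; simp [hpos.ne']

/-- A noticeable large deviation of the norm of a coordinate projection forces the weak moments to
be large. -/
lemma IsIsotropic.exp_mul_le_sigmaX [IsProbabilityMeasure μ] (h : IsIsotropic μ X)
    (hX : Measurable X) (hν : LogConcaveMeasure (μ.map X)) {I : Finset (Fin n)}
    (hI : I.Nonempty) {p b : ℝ} (hp : 1 ≤ p) (hb : 700 * √(I.card) ≤ b)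
    (htail : Real.exp (-(4 * p)) ≤ (μ.map X).real {x | b ≤ ‖coordProj I x‖}) :
    Real.exp (-90004) / 100 * b ≤ sigmaX μ X p := by
  have hm := measurable_coordProj I
  have : IsProbabilityMeasure (μ.map X) := Measure.isProbabilityMeasure_map hX.aemeasurable
  have : IsProbabilityMeasure ((μ.map X).map (coordProj I)) :=
    Measure.isProbabilityMeasure_map hm.aemeasurable
  have hcard : (0 : ℝ) < I.card := by exact_mod_cast hI.card_pos
  have hM : 0 < √(I.card : ℝ) := Real.sqrt_pos.2 hcard
  have hb0 : 0 < b := by linarith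
  have hball := h.measureReal_norm_coordProj_le hX I hM (Real.sq_sqrt hcard.le).ge
  have ha2 : (300 * √p) ^ 2 = 90000 * p := by
    rw [mul_pow, Real.sq_sqrt (by linarith)]; norm_num
  have ha : 300 ≤ 300 * √p := by
    have : 1 ≤ √p := Real.one_le_sqrt.2 hp
    linarith
  have hSm : MeasurableSet {x : EuclideanSpace ℝ (Fin n) | b ≤ ‖x‖} :=
    measurableSet_le (by fun_prop) (by fun_prop)
  have hS : ((μ.map X).map (coordProj I)).real {x | b ≤ ‖x‖} =
      (μ.map X).real {x | b ≤ ‖coordProj I x‖} := map_measureReal_apply hm hSm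
  obtain ⟨v, hv, hdev⟩ := (hν.map (coordProj I) hm).exists_inner_deviation hM hb ha hball (by
    rw [hS, ha2]
    exact (Real.exp_le_exp.2 (by linarith)).trans htail)
  rw [hS, ha2, map_measureReal_apply hm (measurableSet_le (by fun_prop) (by fun_prop)),
    map_measureReal_apply hX (hm (measurableSet_le (by fun_prop) (by fun_prop)))] at hdev
  have hset : X ⁻¹' (coordProj I ⁻¹' {x | b / 100 ≤ ⟪v, x⟫}) =
      {ω | b / 100 ≤ ⟪coordProj I v, X ω⟫} := by
    ext ω
    simp [inner_coordProj]
  rw [hset] at hdev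
  have hp0 : 0 < p := by linarith
  have hup := measureReal_le_inner_le_of_norm_le_one hX hp0 (h.integrable_norm_rpow hX hν hp0)
    ((norm_coordProj_le I v).trans hv.le) (show 0 < b / 100 by positivity)
  have hlow : Real.exp (-90004) ^ p ≤ (sigmaX μ X p / (b / 100)) ^ p := by
    calc Real.exp (-90004) ^ p = Real.exp (-(90000 * p)) * Real.exp (-(4 * p)) := by
          rw [← Real.exp_mul, ← Real.exp_add]; congr 1; ring
      _ ≤ Real.exp (-(90000 * p)) * (μ.map X).real {x | b ≤ ‖coordProj I x‖} := by gcongr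
      _ ≤ _ := hdev.le.trans hup
  have hfin := (Real.rpow_le_rpow_iff (Real.exp_nonneg _)
    (div_nonneg (sigmaX_nonneg p) (by positivity)) hp0).1 hlow
  rw [le_div_iff₀ (by positivity)] at hfin
  linarith

end Isotropic

section LevelSets

variable {n : ℕ}

/-- If a log-concave measure charges a far half-space inside a convex set, then it charges the
complement of a thin slab inside that set. -/
lemma LogConcaveMeasure.quarter_le_measureReal_abs {ν : Measure (EuclideanSpace ℝ (Fin n))}
    [IsProbabilityMeasure ν] (hν : LogConcaveMeasure ν) {W : Set (EuclideanSpace ℝ (Fin n))}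
    (hW : Convex ℝ W) (hWm : MeasurableSet W) (hW0 : 0 < ν.real W) {i : Fin n} {s u : ℝ}
    (hs : 0 < s) (hu : 1 ≤ u) (h : Real.exp (-u) * ν.real W ≤ ν.real (W ∩ {x | s ≤ x i})) :
    ν.real W / 4 ≤ ν.real (W ∩ {x | s / (4 * u) ≤ |x i|}) := by
  by_contra! hlt
  set w := ν.real W
  set H := {x : EuclideanSpace ℝ (Fin n) | s / (4 * u) ≤ |x i|}
  have hHm : MeasurableSet H := measurableSet_le (by fun_prop) (by fun_prop)
  have hSm : MeasurableSet (W ∩ {x | s ≤ x i}) :=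
    hWm.inter (measurableSet_le (by fun_prop) (by fun_prop))
  have hT : 3 / 4 * w ≤ ν.real (W \ H) := by
    have : ν.real (W ∩ H) + ν.real (W \ H) = w := measureReal_inter_add_sdiff hHm
    linarith
  have hu0 : 0 < u := by linarith
  have ha0 : 0 < 1 / (2 * u) := by positivity
  have ha1 : 1 / (2 * u) ≤ 1 / 2 := by gcongr; linarith
  have key := hν _ _ _ hSm (hWm.diff hHm) (hWm.inter hHm) (1 / (2 * u)) ha0 (by linarith) (by
    rintro x ⟨hx, hxs⟩ y ⟨hy, hyH⟩
    refine ⟨hW hx hy ha0.le (by linarith) (by ring), ?_⟩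
    have hxs' : s ≤ x i := hxs
    have hy1 : |y i| < s / (4 * u) := not_le.1 hyH
    have hy2 := (abs_lt.1 hy1).1
    have h1 : 1 / (2 * u) * s ≤ 1 / (2 * u) * x i := by gcongr
    have h2 : (1 - 1 / (2 * u)) * -(s / (4 * u)) ≤ (1 - 1 / (2 * u)) * y i :=
      mul_le_mul_of_nonneg_left hy2.le (by linarith)
    have h3 : 0 ≤ 1 / (2 * u) * (s / (4 * u)) := by positivity
    have h4 : 1 / (2 * u) * s = s / (4 * u) + s / (4 * u) := by field_simp; ring
    change s / (4 * u) ≤ |((1 / (2 * u)) • x + (1 - 1 / (2 * u)) • y) i|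
    refine le_trans ?_ (le_abs_self _)
    simp only [PiLp.add_apply, PiLp.smul_apply, smul_eq_mul]
    linarith)
  set a := 1 / (2 * u) with ha
  have hau : -u * a = -(1 / 2) := by rw [ha]; field_simp
  have e1 : Real.exp (-(1 / 2)) * w ^ a ≤ ν.real (W ∩ {x | s ≤ x i}) ^ a := by
    rw [← hau, Real.exp_mul, ← Real.mul_rpow (Real.exp_nonneg _) hW0.le]
    exact Real.rpow_le_rpow (by positivity) h ha0.le
  have e2 : 3 / 4 * w ^ (1 - a) ≤ ν.real (W \ H) ^ (1 - a) := by
    calc 3 / 4 * w ^ (1 - a) = (3 / 4) ^ (1 : ℝ) * w ^ (1 - a) := by simp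
      _ ≤ (3 / 4) ^ (1 - a) * w ^ (1 - a) := by
        gcongr ?_ * _
        exact Real.rpow_le_rpow_of_exponent_ge (by norm_num) (by norm_num) (by linarith)
      _ = (3 / 4 * w) ^ (1 - a) := (Real.mul_rpow (by norm_num) hW0.le).symm
      _ ≤ _ := Real.rpow_le_rpow (by positivity) hT (by linarith)
  have e3 : w ^ a * w ^ (1 - a) = w := by
    rw [← Real.rpow_add hW0]; simp
  have e4 : (1 / 2 : ℝ) ≤ Real.exp (-(1 / 2)) := by
    have := Real.add_one_le_exp (-(1 / 2))
    linarith
  have e5 : 1 / 2 * (3 / 4) * w ≤ ν.real (W ∩ H) := by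
    calc 1 / 2 * (3 / 4) * w ≤ Real.exp (-(1 / 2)) * (3 / 4) * w := by gcongr
      _ = (Real.exp (-(1 / 2)) * w ^ a) * (3 / 4 * w ^ (1 - a)) := by
        rw [mul_mul_mul_comm, e3]
      _ ≤ _ := (mul_le_mul e1 e2 (by positivity) (by positivity)).trans key
  linarith

lemma eighth_le_measureReal_norm_coordProj {ν : Measure (EuclideanSpace ℝ (Fin n))}
    [IsProbabilityMeasure ν] {W : Set (EuclideanSpace ℝ (Fin n))} (hWm : MeasurableSet W)
    (I : Finset (Fin n)) {s : Fin n → ℝ} (hs : ∀ i ∈ I, 0 < s i) {u : ℝ} (hu : 1 ≤ u)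
    (hV : 0 < ∑ i ∈ I, s i ^ 2)
    (h : ∀ i ∈ I, ν.real W / 4 ≤ ν.real (W ∩ {x | s i / (4 * u) ≤ |x i|})) :
    ν.real W / 8 ≤ ν.real {x | √(∑ i ∈ I, s i ^ 2) / (12 * u) ≤ ‖coordProj I x‖} := by
  set V := ∑ i ∈ I, s i ^ 2 with hV_def
  set H := fun i => {x : EuclideanSpace ℝ (Fin n) | s i / (4 * u) ≤ |x i|} with hH_def
  set G := {x : EuclideanSpace ℝ (Fin n) | √V / (12 * u) ≤ ‖coordProj I x‖} with hG_def
  have hu0 : 0 < u := by linarith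
  have hHm : ∀ i, MeasurableSet (H i) := fun i => measurableSet_le (by fun_prop) (by fun_prop)
  have hGm : MeasurableSet G :=
    measurableSet_le measurable_const (measurable_norm.comp (measurable_coordProj I))
  have hind : ∀ S : Set (EuclideanSpace ℝ (Fin n)), MeasurableSet S →
      Integrable (S.indicator fun _ => (1 : ℝ)) ν := fun S hS => (integrable_const 1).indicator hS
  have hint1 : Integrable (fun x => ∑ i ∈ I, s i ^ 2 * (W ∩ H i).indicator (fun _ => (1 : ℝ)) x) ν :=
    integrable_finsetSum _ fun i _ => (hind _ (hWm.inter (hHm i))).const_mul _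
  have hi2 : Integrable (fun x => V * G.indicator (fun _ => (1 : ℝ)) x) ν :=
    (hind _ hGm).const_mul _
  have hi3 : Integrable (fun x => V / 8 * W.indicator (fun _ => (1 : ℝ)) x) ν :=
    (hind _ hWm).const_mul _
  have hle : ∫ x, ∑ i ∈ I, s i ^ 2 * (W ∩ H i).indicator (fun _ => (1 : ℝ)) x ∂ν ≤
      ∫ x, (V * G.indicator (fun _ => (1 : ℝ)) x + V / 8 * W.indicator (fun _ => (1 : ℝ)) x) ∂ν := by
    refine integral_mono hint1 (hi2.add hi3) fun x => ?_
    have hnn : 0 ≤ V / 8 * W.indicator (fun _ => (1 : ℝ)) x :=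
      mul_nonneg (by positivity) (Set.indicator_nonneg (fun _ _ => zero_le_one) _)
    by_cases hxG : x ∈ G
    · simp only [Set.indicator_of_mem hxG]
      have : ∑ i ∈ I, s i ^ 2 * (W ∩ H i).indicator (fun _ => (1 : ℝ)) x ≤ V := by
        refine Finset.sum_le_sum fun i _ => ?_
        have : (W ∩ H i).indicator (fun _ => (1 : ℝ)) x ≤ 1 :=
          Set.indicator_le_self' (fun _ _ => zero_le_one) x
        exact mul_le_of_le_one_right (sq_nonneg _) this
      linarith
    · by_cases hxW : x ∈ W
      · simp only [Set.indicator_of_notMem hxG, Set.indicator_of_mem hxW]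
        have h1 : ∑ i ∈ I, s i ^ 2 * (W ∩ H i).indicator (fun _ => (1 : ℝ)) x ≤
            (4 * u) ^ 2 * ‖coordProj I x‖ ^ 2 := by
          rw [norm_coordProj_sq, Finset.mul_sum]
          refine Finset.sum_le_sum fun i hi => ?_
          by_cases hxH : x ∈ W ∩ H i
          · rw [Set.indicator_of_mem hxH, mul_one]
            have h2 : s i / (4 * u) ≤ |x i| := hxH.2
            rw [div_le_iff₀ (by positivity)] at h2
            calc s i ^ 2 ≤ (|x i| * (4 * u)) ^ 2 := by
                  have := (hs i hi).le
                  gcongr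
              _ = (4 * u) ^ 2 * x i ^ 2 := by rw [mul_pow, sq_abs]; ring
          · rw [Set.indicator_of_notMem hxH, mul_zero]; positivity
        have h3 : ‖coordProj I x‖ ^ 2 ≤ (√V / (12 * u)) ^ 2 := by
          have : ‖coordProj I x‖ < √V / (12 * u) := not_le.1 hxG
          gcongr
        have h4 : (4 * u) ^ 2 * (√V / (12 * u)) ^ 2 = V / 9 := by
          rw [div_pow, Real.sq_sqrt hV.le]; field_simp; norm_num
        have h5 : (4 * u) ^ 2 * ‖coordProj I x‖ ^ 2 ≤ (4 * u) ^ 2 * (√V / (12 * u)) ^ 2 := by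
          gcongr
        linarith
      · simp [hxG, hxW]
  rw [integral_add hi2 hi3, integral_const_mul, integral_const_mul,
    integral_indicator_const _ hGm, integral_indicator_const _ hWm,
    integral_finsetSum _ fun i _ => (hind _ (hWm.inter (hHm i))).const_mul _] at hle
  simp_rw [integral_const_mul, integral_indicator_const _ (hWm.inter (hHm _)), smul_eq_mul,
    mul_one] at hle
  have hlow : V * (ν.real W / 4) ≤ ∑ i ∈ I, s i ^ 2 * ν.real (W ∩ H i) := by
    rw [hV_def, Finset.sum_mul]
    exact Finset.sum_le_sum fun i hi => mul_le_mul_of_nonneg_left (h i hi) (sq_nonneg _)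
  have : V * (ν.real W / 8) ≤ V * ν.real G := by linarith
  exact le_of_mul_le_mul_left this hV

/-- Weighted version of the level set estimate, with one high level per coordinate. -/
lemma IsIsotropic.sum_sq_le_sigmaX {μ : Measure Ω} [IsProbabilityMeasure μ]
    {X : Ω → EuclideanSpace ℝ (Fin n)} (h : IsIsotropic μ X) (hX : Measurable X)
    (hν : LogConcaveMeasure (μ.map X)) {W : Set (EuclideanSpace ℝ (Fin n))} (hW : Convex ℝ W)
    (hWm : MeasurableSet W) (hW0 : 0 < (μ.map X).real W)
    (hW1 : (μ.map X).real W ≤ 1 / Real.exp 1) {u : ℝ} (hu : 1 ≤ u) (I : Finset (Fin n))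
    {s : Fin n → ℝ} (hs : ∀ i ∈ I, 8400 * u ≤ s i)
    (hlev : ∀ i ∈ I,
      Real.exp (-u) * (μ.map X).real W ≤ (μ.map X).real (W ∩ {x | s i ≤ x i})) :
    ∑ i ∈ I, s i ^ 2 ≤
      (1200 / Real.exp (-90004)) ^ 2 * u ^ 2 *
        sigmaX μ X (-Real.log ((μ.map X).real W)) ^ 2 := by
  have : IsProbabilityMeasure (μ.map X) := Measure.isProbabilityMeasure_map hX.aemeasurable
  rcases I.eq_empty_or_nonempty with rfl | hI
  · simp only [Finset.sum_empty]; positivity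
  set w := (μ.map X).real W
  set p := -Real.log w with hp_def
  have hu0 : 0 < u := by linarith
  have hp : 1 ≤ p := by
    have h1 := Real.log_le_log hW0 hW1
    rw [one_div, Real.log_inv, Real.log_exp] at h1
    linarith
  have hwp : w = Real.exp (-p) := by rw [hp_def, neg_neg, Real.exp_log hW0]
  have hs0 : ∀ i ∈ I, 0 < s i := fun i hi => by have := hs i hi; linarith
  have hVcard : (I.card : ℝ) * (8400 * u) ^ 2 ≤ ∑ i ∈ I, s i ^ 2 := by
    rw [← nsmul_eq_mul]
    refine Finset.card_nsmul_le_sum _ _ _ fun i hi => ?_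
    have := hs i hi
    gcongr
  have hcard : (0 : ℝ) < I.card := by exact_mod_cast hI.card_pos
  have hV : 0 < ∑ i ∈ I, s i ^ 2 := lt_of_lt_of_le (by positivity) hVcard
  have hb : 700 * √(I.card) ≤ √(∑ i ∈ I, s i ^ 2) / (12 * u) := by
    rw [le_div_iff₀ (by positivity)]
    refine Real.le_sqrt_of_sq_le ?_
    calc (700 * √(I.card) * (12 * u)) ^ 2 = √(I.card) ^ 2 * (8400 * u) ^ 2 := by ring
      _ = I.card * (8400 * u) ^ 2 := by rw [Real.sq_sqrt hcard.le]
      _ ≤ _ := hVcard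
  have htail := eighth_le_measureReal_norm_coordProj hWm I hs0 hu hV fun i hi =>
    hν.quarter_le_measureReal_abs hW hWm hW0 (hs0 i hi) hu (hlev i hi)
  have hsig := h.exp_mul_le_sigmaX hX hν hI hp hb (by
    refine le_trans ?_ htail
    have h8 : Real.exp (-3) ≤ 1 / 8 := by
      rw [Real.exp_neg, one_div]
      gcongr
      calc (8 : ℝ) = 2 ^ 3 := by norm_num
        _ ≤ Real.exp 1 ^ 3 := by gcongr; exact Real.exp_one_gt_two.le
        _ = Real.exp 3 := by rw [← Real.exp_nat_mul]; norm_num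
    calc Real.exp (-(4 * p)) ≤ Real.exp (-p) * Real.exp (-3) := by
          rw [← Real.exp_add]; apply Real.exp_le_exp.2; linarith
      _ ≤ w * (1 / 8) := by rw [hwp]; gcongr
      _ = w / 8 := by ring)
  have hroot : √(∑ i ∈ I, s i ^ 2) ≤ 1200 / Real.exp (-90004) * u * sigmaX μ X p := by
    calc √(∑ i ∈ I, s i ^ 2) = 1200 / Real.exp (-90004) * u *
          (Real.exp (-90004) / 100 * (√(∑ i ∈ I, s i ^ 2) / (12 * u))) := by
          field_simp; norm_num
      _ ≤ _ := by gcongr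
  calc ∑ i ∈ I, s i ^ 2 = √(∑ i ∈ I, s i ^ 2) ^ 2 := (Real.sq_sqrt hV.le).symm
    _ ≤ (1200 / Real.exp (-90004) * u * sigmaX μ X p) ^ 2 := by gcongr
    _ = _ := by ring

lemma sum_four_pow_le {t c : ℝ} (ht : 0 < t) (S : Finset ℕ)
    (h : ∀ k ∈ S, (2 : ℝ) ^ k * t ≤ c) : ∑ k ∈ S, (4 : ℝ) ^ k ≤ 4 * c ^ 2 / t ^ 2 := by
  rcases S.eq_empty_or_nonempty with rfl | hS
  · simp only [Finset.sum_empty]; positivity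
  obtain ⟨m, hm, hmax⟩ := S.exists_max_image id hS
  have h1 : ∑ k ∈ S, (4 : ℝ) ^ k ≤ 4 ^ (m + 1) := by
    have := Nat.geomSum_lt (m := 4) (n := m + 1) (s := S) (by norm_num)
      fun k hk => Nat.lt_succ_of_le (hmax k hk)
    exact_mod_cast this.le
  refine h1.trans ?_
  rw [le_div_iff₀ (by positivity)]
  calc (4 : ℝ) ^ (m + 1) * t ^ 2 = 4 * ((2 : ℝ) ^ m * t) ^ 2 := by
        rw [mul_pow, ← pow_mul, mul_comm m 2, pow_mul]; norm_num; ring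
    _ ≤ 4 * c ^ 2 := by
        have := h m hm
        gcongr

/-- Summing a family of levels in which all coordinates above a threshold are controlled. -/
lemma sum_four_pow_mul_card_le {t c B : ℝ} (ht : 0 < t) (J : ℕ → Finset (Fin n))
    (hJ : ∀ (I : Finset (Fin n)) (s : Fin n → ℝ),
      (∀ i ∈ I, c ≤ s i ∧ ∃ k, i ∈ J k ∧ s i = (2 : ℝ) ^ k * t) → ∑ i ∈ I, s i ^ 2 ≤ B) (N : ℕ) :
    ∑ k ∈ Finset.range N, (4 : ℝ) ^ k * (J k).card ≤
      4 * B / t ^ 2 + if t ≤ c then 4 * c ^ 2 / t ^ 2 * n else 0 := by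
  set S : Fin n → Finset ℕ := fun i => (Finset.range N).filter fun k => i ∈ J k with hS
  have hswap : ∑ k ∈ Finset.range N, (4 : ℝ) ^ k * (J k).card =
      ∑ i, ∑ k ∈ S i, (4 : ℝ) ^ k := by
    simp_rw [hS, Finset.sum_filter]
    rw [Finset.sum_comm]
    refine Finset.sum_congr rfl fun k _ => ?_
    rw [← Finset.sum_filter, Finset.sum_const, nsmul_eq_mul, mul_comm]
    simp
  set Hi : Fin n → Finset ℕ := fun i => (S i).filter fun k => c ≤ (2 : ℝ) ^ k * t with hHi
  set Lo : Fin n → Finset ℕ := fun i => (S i).filter fun k => ¬ c ≤ (2 : ℝ) ^ k * t with hLo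
  have hsplit : ∀ i, ∑ k ∈ S i, (4 : ℝ) ^ k = ∑ k ∈ Hi i, (4 : ℝ) ^ k + ∑ k ∈ Lo i, (4 : ℝ) ^ k :=
    fun i => (Finset.sum_filter_add_sum_filter_not _ _ _).symm
  have hlow : ∀ i, ∑ k ∈ Lo i, (4 : ℝ) ^ k ≤ if t ≤ c then 4 * c ^ 2 / t ^ 2 else 0 := by
    intro i
    split_ifs with htc
    · exact sum_four_pow_le ht _ fun k hk => (not_le.1 (Finset.mem_filter.1 hk).2).le
    · have : Lo i = ∅ := by
        refine Finset.filter_eq_empty_iff.2 fun k _ => ?_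
        rw [not_not]
        have : (1 : ℝ) ≤ 2 ^ k := one_le_pow₀ (by norm_num)
        nlinarith
      rw [this, Finset.sum_empty]
  set I : Finset (Fin n) := Finset.univ.filter fun i => (Hi i).Nonempty with hI
  have hex : ∀ i : Fin n, ∃ r : ℝ, i ∈ I →
      (c ≤ r ∧ ∃ k, i ∈ J k ∧ r = (2 : ℝ) ^ k * t) ∧
        ∑ k ∈ Hi i, (4 : ℝ) ^ k ≤ 4 * r ^ 2 / t ^ 2 := by
    intro i
    by_cases hi : i ∈ I
    · obtain ⟨m, hm, hmax⟩ := (Hi i).exists_max_image id (Finset.mem_filter.1 hi).2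
      refine ⟨2 ^ m * t, fun _ => ⟨⟨(Finset.mem_filter.1 hm).2, m, ?_, rfl⟩, ?_⟩⟩
      · exact (Finset.mem_filter.1 (Finset.mem_filter.1 hm).1).2
      · refine sum_four_pow_le ht _ fun k hk => ?_
        have : k ≤ m := hmax k hk
        gcongr
        norm_num
    · exact ⟨0, fun h => absurd h hi⟩
  choose s hs using hex
  have hhigh : ∑ i, ∑ k ∈ Hi i, (4 : ℝ) ^ k ≤ 4 * B / t ^ 2 := by
    calc ∑ i, ∑ k ∈ Hi i, (4 : ℝ) ^ k = ∑ i ∈ I, ∑ k ∈ Hi i, (4 : ℝ) ^ k := by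
          symm
          refine Finset.sum_subset (Finset.subset_univ _) fun i _ hi => ?_
          have : Hi i = ∅ := by
            by_contra hne
            exact hi (Finset.mem_filter.2
              ⟨Finset.mem_univ _, Finset.nonempty_iff_ne_empty.2 hne⟩)
          rw [this, Finset.sum_empty]
      _ ≤ ∑ i ∈ I, 4 * s i ^ 2 / t ^ 2 := Finset.sum_le_sum fun i hi => (hs i hi).2
      _ = 4 * (∑ i ∈ I, s i ^ 2) / t ^ 2 := by rw [Finset.mul_sum, Finset.sum_div]
      _ ≤ _ := by
        gcongr
        exact hJ I s fun i hi => (hs i hi).1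
  have hlows : ∑ i, ∑ k ∈ Lo i, (4 : ℝ) ^ k ≤ if t ≤ c then 4 * c ^ 2 / t ^ 2 * n else 0 := by
    refine (Finset.sum_le_sum fun i _ => hlow i).trans_eq ?_
    rw [Finset.sum_const, Finset.card_univ, Fintype.card_fin, nsmul_eq_mul]
    split_ifs <;> ring
  rw [hswap]
  simp_rw [hsplit]
  rw [Finset.sum_add_distrib]
  exact add_le_add hhigh hlows

end LevelSets

/-- Up to a null set, an isotropic log-concave vector does not distinguish a convex set from its
interior. -/
lemma IsIsotropic.measureReal_interior_inter {n : ℕ} {μ : Measure Ω} [IsProbabilityMeasure μ]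
    {X : Ω → EuclideanSpace ℝ (Fin n)} (h : IsIsotropic μ X) (hX : Measurable X)
    (hν : LogConcaveMeasure (μ.map X)) {K : Set (EuclideanSpace ℝ (Fin n))} (hK : Convex ℝ K)
    {E : Set (EuclideanSpace ℝ (Fin n))} (hE : MeasurableSet E) :
    (μ.map X).real (interior K ∩ E) = μ.real (X ⁻¹' K ∩ X ⁻¹' E) := by
  have : IsProbabilityMeasure (μ.map X) := Measure.isProbabilityMeasure_map hX.aemeasurable
  have hfr := hν.measureReal_frontier_eq_zero (h.measureReal_hyperplane hX hν) hK
  rw [map_measureReal_apply hX isClosed_frontier.measurableSet] at hfr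
  rw [map_measureReal_apply hX (isOpen_interior.measurableSet.inter hE)]
  refine le_antisymm (measureReal_mono fun ω hω => ⟨show X ω ∈ K from interior_subset hω.1, hω.2⟩) ?_
  have hsub : X ⁻¹' K ∩ X ⁻¹' E ⊆ X ⁻¹' (interior K ∩ E) ∪ X ⁻¹' frontier K := by
    rintro ω ⟨hω, hωE⟩
    by_cases hi : X ω ∈ interior K
    · exact Or.inl ⟨hi, hωE⟩
    · exact Or.inr ⟨subset_closure hω, hi⟩
  calc μ.real (X ⁻¹' K ∩ X ⁻¹' E)
      ≤ μ.real (X ⁻¹' (interior K ∩ E) ∪ X ⁻¹' frontier K) := measureReal_mono hsub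
    _ ≤ _ := measureReal_union_le _ _
    _ = _ := by rw [hfr, add_zero]

/-- **Proposition (conditional estimate, part 2).** There is a universal constant `C > 0` such
that for every isotropic log-concave random vector `X` in `ℝⁿ`, every convex set `K ⊆ ℝⁿ` with
`A = {X ∈ K}` satisfying `0 < P(A) ≤ 1/e`, every `t > 0` and every `u ≥ 1`,
`∑ₖ 4^k·#{i : P(A ∩ {Xᵢ ≥ 2^k t}) ≥ e^{−u} P(A)} ≤ (C·u²/t²)·(σ_X(−log P(A))² + n·𝟙{t ≤ uC})`. -/
theorem conditional_level_sets :
    ∃ C : ℝ, 0 < C ∧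
      ∀ (Ω : Type) (_ : MeasurableSpace Ω) (μ : Measure Ω), IsProbabilityMeasure μ →
      ∀ (n : ℕ) (X : Ω → EuclideanSpace ℝ (Fin n)), Measurable X →
      IsLogConcave μ X → IsIsotropic μ X →
      ∀ K : Set (EuclideanSpace ℝ (Fin n)), Convex ℝ K →
        0 < (μ (X ⁻¹' K)).toReal → (μ (X ⁻¹' K)).toReal ≤ 1 / Real.exp 1 →
      ∀ t : ℝ, 0 < t → ∀ u : ℝ, 1 ≤ u →
        ∑' k : ℕ, (4 : ℝ) ^ k *
            (Nat.card {i : Fin n //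
              Real.exp (-u) * (μ (X ⁻¹' K)).toReal ≤
                (μ (X ⁻¹' K ∩ {ω | (2 : ℝ) ^ k * t ≤ X ω i})).toReal} : ℝ) ≤
          C * u ^ 2 / t ^ 2 *
            ((sigmaX μ X (-Real.log (μ (X ⁻¹' K)).toReal)) ^ 2 +
              if t ≤ u * C then (n : ℝ) else 0) := by
  classical
  obtain ⟨D, hD⟩ : ∃ D : ℝ, D = 1200 / Real.exp (-90004) := ⟨_, rfl⟩
  refine ⟨4 * D ^ 2 + 4 * 8400 ^ 2, by positivity, ?_⟩
  intro Ω _ μ _ n X hX hlc hiso K hK hK0 hK1 t ht u hu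
  have hν := hlc.logConcaveMeasure_map hX
  have hu0 : 0 < u := by linarith
  have hWE := fun E (hE : MeasurableSet E) => hiso.measureReal_interior_inter hX hν hK hE
  have hW : (μ.map X).real (interior K) = (μ (X ⁻¹' K)).toReal := by
    have := hWE Set.univ MeasurableSet.univ
    rwa [Set.preimage_univ, Set.inter_univ, Set.inter_univ] at this
  have hlev : ∀ (i : Fin n) (r : ℝ), (μ.map X).real (interior K ∩ {x | r ≤ x i}) =
      (μ (X ⁻¹' K ∩ {ω | r ≤ X ω i})).toReal :=
    fun i r => hWE _ (measurableSet_le (by fun_prop) (by fun_prop))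
  set w := (μ (X ⁻¹' K)).toReal with hw
  set J : ℕ → Finset (Fin n) := fun k => Finset.univ.filter fun i =>
    Real.exp (-u) * w ≤ (μ (X ⁻¹' K ∩ {ω | (2 : ℝ) ^ k * t ≤ X ω i})).toReal with hJ
  have hcard : ∀ k, Nat.card {i : Fin n //
      Real.exp (-u) * w ≤ (μ (X ⁻¹' K ∩ {ω | (2 : ℝ) ^ k * t ≤ X ω i})).toReal} =
        (J k).card := fun k => by
    rw [Nat.card_eq_fintype_card, Fintype.card_subtype]
  simp_rw [hcard]
  set σ := sigmaX μ X (-Real.log w) with hσ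
  have hB : ∀ (I : Finset (Fin n)) (s : Fin n → ℝ),
      (∀ i ∈ I, 8400 * u ≤ s i ∧ ∃ k, i ∈ J k ∧ s i = (2 : ℝ) ^ k * t) →
        ∑ i ∈ I, s i ^ 2 ≤ D ^ 2 * u ^ 2 * σ ^ 2 := by
    intro I s hs
    have := hiso.sum_sq_le_sigmaX hX hν hK.interior isOpen_interior.measurableSet
      (by rwa [hW]) (by rwa [hW]) hu I (fun i hi => (hs i hi).1) (by
        intro i hi
        obtain ⟨k, hk, hsk⟩ := (hs i hi).2
        rw [hW, hlev, hsk]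
        exact (Finset.mem_filter.1 hk).2)
    rwa [hW, ← hD] at this
  refine Real.tsum_le_of_sum_range_le (fun k => by positivity) fun N => ?_
  refine (sum_four_pow_mul_card_le ht J hB N).trans ?_
  have hσ2 : 0 ≤ u ^ 2 / t ^ 2 * σ ^ 2 := by positivity
  have hn : 0 ≤ u ^ 2 / t ^ 2 * n := by positivity
  have hfirst : 4 * (D ^ 2 * u ^ 2 * σ ^ 2) / t ^ 2 ≤
      (4 * D ^ 2 + 4 * 8400 ^ 2) * u ^ 2 / t ^ 2 * σ ^ 2 := by
    calc 4 * (D ^ 2 * u ^ 2 * σ ^ 2) / t ^ 2 = 4 * D ^ 2 * (u ^ 2 / t ^ 2 * σ ^ 2) := by ring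
      _ ≤ (4 * D ^ 2 + 4 * 8400 ^ 2) * (u ^ 2 / t ^ 2 * σ ^ 2) := by
        gcongr; linarith
      _ = _ := by ring
  have hsecond : (if t ≤ 8400 * u then 4 * (8400 * u) ^ 2 / t ^ 2 * n else 0) ≤
      (4 * D ^ 2 + 4 * 8400 ^ 2) * u ^ 2 / t ^ 2 *
        (if t ≤ u * (4 * D ^ 2 + 4 * 8400 ^ 2) then (n : ℝ) else 0) := by
    split_ifs with h1 h2 h2
    · calc 4 * (8400 * u) ^ 2 / t ^ 2 * n = 4 * 8400 ^ 2 * (u ^ 2 / t ^ 2 * n) := by ring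
        _ ≤ (4 * D ^ 2 + 4 * 8400 ^ 2) * (u ^ 2 / t ^ 2 * n) := by
          gcongr; nlinarith [sq_nonneg D]
        _ = _ := by ring
    · exact absurd (h1.trans (by nlinarith [sq_nonneg D])) h2
    · positivity
    · simp
  rw [mul_add]
  exact add_le_add hfirst hsecond

end
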